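/- Let (k,ℓ) = (4,1) or (3,2), let n ≥ 1, and let p = 5m+3 be a prime (so λ = 1 and k+ℓ = 5). Let τ ∈ (0,1] be feasible for 1/5 and assume m ≥ 5/τ and m ≥ 21. If A ⊆ F_p^n is a nontrivial (k,ℓ)-sum-free set with |A| ≥ m·p^{n−1}, then A is normal (type 1 or type 2), or of type 3, or of type 4. -/

import Mathlib

open Pointwise

/-- `itSum h A` is the `h`-fold sumset `hA = A + ⋯ + A` (`h` copies), with `itSum 0 A = {0}`. -/
def itSum {G : Type*} [AddCommMonoid G] : ℕ → Set G → Set G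
  | 0, _ => {0}
  | h + 1, A => itSum h A + A

/-- `A` is `(k,ℓ)`-sum-free: the sumsets `kA` and `ℓA` are disjoint. -/
def KLFree {G : Type*} [AddCommMonoid G] (k l : ℕ) (A : Set G) : Prop :=
  itSum k A ∩ itSum l A = ∅

/-- The interval `[a, a+t] = {a, a+1, …, a+t}` in `ZMod p`. -/
def Ival {p : ℕ} (a : ZMod p) (t : ℕ) : Set (ZMod p) :=
  {x | ∃ i : ℕ, i ≤ t ∧ x = a + (i : ZMod p)}

/-- The cuboid `[a, a+t] × F_p^{n'}` inside the model space `F_p × F_p^{n'}`. -/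
def cub (p n' : ℕ) (a : ZMod p) (t : ℕ) : Set (ZMod p × (Fin n' → ZMod p)) :=
  {x | x.1 ∈ Ival a t}

/-- The element `a_j = -(km+1+j)·(k-ℓ)⁻¹` of `F_p`. -/
def ajElt (k l m p j : ℕ) : ZMod p :=
  -((k * m + 1 + j : ℕ) : ZMod p) * (((k - l : ℕ) : ZMod p))⁻¹

/-- The layer `A_i = (A - i·v) ∩ K` of `A` w.r.t. the decomposition `(v, K)`. -/
def layerKL {p n : ℕ} (v : Fin n → ZMod p) (K : Submodule (ZMod p) (Fin n → ZMod p))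
    (A : Set (Fin n → ZMod p)) (i : ZMod p) : Set (Fin n → ZMod p) :=
  {x | x ∈ K ∧ x + i • v ∈ A}

/-- The support `Supp(A) = {i | A_i ≠ ∅}` w.r.t. the decomposition `(v, K)`. -/
def supp {p n : ℕ} (v : Fin n → ZMod p) (K : Submodule (ZMod p) (Fin n → ZMod p))
    (A : Set (Fin n → ZMod p)) : Set (ZMod p) :=
  {i | (layerKL v K A i).Nonempty}

/-- The weight `ω(A) = |Supp(A)|` w.r.t. the decomposition `(v, K)`. -/
noncomputable def weight {p n : ℕ} (v : Fin n → ZMod p)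
    (K : Submodule (ZMod p) (Fin n → ZMod p)) (A : Set (Fin n → ZMod p)) : ℕ :=
  (supp v K A).ncard

/-- `A ⊆ F_p^n` is trivial: isomorphic to a subset of some extremal cuboid `A_{k,ℓ,p,j}`. -/
def IsTrivialKL (k l m lam p n : ℕ) (A : Set (Fin n → ZMod p)) : Prop :=
  ∃ (e : (Fin n → ZMod p) ≃+ (ZMod p × (Fin (n - 1) → ZMod p))) (j : ℕ),
    j < (lam + 2) / 2 ∧ e '' A ⊆ cub p (n - 1) (ajElt k l m p j) m

/-- Type 1. -/
def IsType1 (k l m lam p n : ℕ) (A : Set (Fin n → ZMod p)) : Prop :=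
  A.ncard = m * p ^ (n - 1) ∧
  ∃ (e : (Fin n → ZMod p) ≃+ (ZMod p × (Fin (n - 1) → ZMod p))) (a : ZMod p),
    ((l : ZMod p) * a - (k : ZMod p) * (a + (m : ZMod p) - 1) ∈ Ival (1 : ZMod p) (l - 1) ∨
      (lam + l + 2 ≤ k ∧
        (l : ZMod p) * a - (k : ZMod p) * (a + (m : ZMod p) - 1) ∈
          Ival ((lam + l + 2 : ℕ) : ZMod p) (k - (lam + l + 2)))) ∧
    e '' A = cub p (n - 1) a (m - 1)

/-- The element `a = m·k·(ℓ-k)⁻¹` of `F_p` used in type 2. -/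
def type2a (k l m p : ℕ) : ZMod p :=
  (m : ZMod p) * (k : ZMod p) * (((l : ZMod p) - (k : ZMod p))⁻¹)

/-- Type 2. -/
def IsType2 (k l m p n : ℕ) (A : Set (Fin n → ZMod p)) : Prop :=
  l = 1 ∧ 2 ≤ n ∧ A.ncard = m * p ^ (n - 1) ∧
  ∃ (e : (Fin n → ZMod p) ≃+ (ZMod p × (Fin (n - 1) → ZMod p)))
      (V : Submodule (ZMod p) (Fin (n - 1) → ZMod p)),
    V ≠ ⊤ ∧
    e '' A =
      ({type2a k l m p} ×ˢ (Set.univ \ (V : Set (Fin (n - 1) → ZMod p)))) ∪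
        ((Ival (type2a k l m p + 1) (m - 2)) ×ˢ (Set.univ : Set (Fin (n - 1) → ZMod p))) ∪
        ({type2a k l m p + (m : ZMod p)} ×ˢ (V : Set (Fin (n - 1) → ZMod p)))

/-- Normal: of type 1 or type 2. -/
def IsNormalKL (k l m lam p n : ℕ) (A : Set (Fin n → ZMod p)) : Prop :=
  IsType1 k l m lam p n A ∨ IsType2 k l m p n A

/-- The element `a = (ℓm+k-1)·(k-ℓ)⁻¹` of `F_p` used in type 3. -/
def type3a (k l m p : ℕ) : ZMod p :=
  ((l * m + k - 1 : ℕ) : ZMod p) * (((k - l : ℕ) : ZMod p))⁻¹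

/-- Type 3. -/
def IsType3 (k l m p n : ℕ) (A : Set (Fin n → ZMod p)) : Prop :=
  A.ncard = m * p ^ (n - 1) ∧
  ∃ e : (Fin n → ZMod p) ≃+ (ZMod p × (Fin (n - 1) → ZMod p)),
    e '' A = {x | x.1 ∈ Ival (type3a k l m p - 1) (m + 1) \
      {type3a k l m p, type3a k l m p + (m : ZMod p) - 1}}

/-- Type 4 (for `p = 5m+3`). -/
def IsType4 (m p n : ℕ) (A : Set (Fin n → ZMod p)) : Prop :=
  2 ≤ n ∧ A.ncard = m * p ^ (n - 1) ∧
  ∃ (e : (Fin n → ZMod p) ≃+ (ZMod p × (Fin (n - 1) → ZMod p)))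
      (V : Submodule (ZMod p) (Fin (n - 1) → ZMod p)),
    V ≠ ⊤ ∧
    e '' A =
      (({((2 * m + 1 : ℕ) : ZMod p), ((3 * m + 2 : ℕ) : ZMod p)} : Set (ZMod p)) ×ˢ
          (V : Set (Fin (n - 1) → ZMod p))) ∪
        (({((2 * m + 2 : ℕ) : ZMod p), ((3 * m + 1 : ℕ) : ZMod p)} : Set (ZMod p)) ×ˢ
          (Set.univ \ (V : Set (Fin (n - 1) → ZMod p)))) ∪
        ((Ival ((2 * m + 3 : ℕ) : ZMod p) (m - 3)) ×ˢ (Set.univ : Set (Fin (n - 1) → ZMod p)))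

/-- The set `A₀ ⊆ F_p × F_p^s` used in type 5 (for `p = 4m+3`), with `a = (m+2)/2`. -/
def type5A0 (m p s : ℕ) (P : Set (Fin s → ZMod p)) : Set (ZMod p × (Fin s → ZMod p)) :=
  {(((m + 2 : ℕ) : ZMod p) * (2 : ZMod p)⁻¹ - 1, (0 : Fin s → ZMod p))} ∪
    ({((m + 2 : ℕ) : ZMod p) * (2 : ZMod p)⁻¹} ×ˢ (Set.univ \ P)) ∪
    ((Ival (((m + 2 : ℕ) : ZMod p) * (2 : ZMod p)⁻¹ + 1) (m - 3)) ×ˢ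
      (Set.univ : Set (Fin s → ZMod p))) ∪
    ({((m + 2 : ℕ) : ZMod p) * (2 : ZMod p)⁻¹ + (m : ZMod p) - 1} ×ˢ
      (Set.univ \ {(0 : Fin s → ZMod p)})) ∪
    ({((m + 2 : ℕ) : ZMod p) * (2 : ZMod p)⁻¹ + (m : ZMod p)} ×ˢ P)

/-- Type 5 (for `p = 4m+3`). -/
def IsType5 (m p n : ℕ) (A : Set (Fin n → ZMod p)) : Prop :=
  A.ncard = m * p ^ (n - 1) ∧
  ∃ s : ℕ, s ≤ n - 1 ∧
    ∃ (e : (Fin n → ZMod p) ≃+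
          (ZMod p × (Fin s → ZMod p) × (Fin (n - 1 - s) → ZMod p)))
      (P : Set (Fin s → ZMod p)),
      P.Nonempty ∧ (0 : Fin s → ZMod p) ∉ itSum 3 P ∧
      e '' A = {x | (x.1, x.2.1) ∈ type5A0 m p s P}

/-- `τ` is feasible for `c`. -/
def Feasible (c τ : ℝ) : Prop :=
  ∀ q : ℕ, q.Prime → ∀ B : Set (ZMod q),
    (B.ncard : ℝ) ≤ c * q →
    ((B + B).ncard : ℝ) ≤ (2 + τ) * (B.ncard : ℝ) - 3 →
    ∃ y d : ZMod q, d ≠ 0 ∧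
      B ⊆ {x | ∃ i : ℕ, i ≤ (B + B).ncard - B.ncard ∧ x = y + (i : ZMod q) * d}

open Finset in
/-- If every proper subgroup of `G` has index at least `p`, then either `X + Y = G` or
`|X + Y| ≥ |X| + |Y| - |G| / p`. -/
theorem card_add_ge_of_zero_mem {G : Type*} [AddCommGroup G] [Fintype G] [DecidableEq G] (p : ℕ)
    (hH : ∀ H : AddSubgroup G, H ≠ ⊤ → p * Nat.card H ≤ Fintype.card G) (c : ℕ) :
    ∀ X Y : Finset G, Y.card = c → X.Nonempty → (0 : G) ∈ Y →
      X + Y = univ ∨ p * X.card + p * Y.card ≤ p * (X + Y).card + Fintype.card G := by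
  induction c using Nat.strong_induction_on with
  | _ c ih =>
    intro X Y hc hX h0
    by_cases hst : ∀ x ∈ X, ∀ y ∈ Y, x + y ∈ X
    · have hYs : ∀ y ∈ Y, y ∈ AddAction.stabilizer G X := by
        intro y hy
        rw [AddAction.mem_stabilizer_iff]
        refine Finset.eq_of_subset_of_card_le ?_ (by simp)
        intro z hz
        obtain ⟨x, hx, rfl⟩ := Finset.mem_vadd_finset.1 hz
        rw [vadd_eq_add, add_comm]
        exact hst x hx y hy
      by_cases ht : AddAction.stabilizer G X = ⊤
      · left
        obtain ⟨x, hx⟩ := hX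
        rw [Finset.eq_univ_iff_forall]
        intro g
        have hg : g - x ∈ AddAction.stabilizer G X := by rw [ht]; trivial
        rw [AddAction.mem_stabilizer_iff] at hg
        have hgX : g ∈ X := by
          rw [← hg, Finset.mem_vadd_finset]
          exact ⟨x, hx, by simp⟩
        simpa using Finset.add_mem_add hgX h0
      · right
        have h1 := hH _ ht
        have h2 : Y.card ≤ Nat.card (AddAction.stabilizer G X) := by
          have h := Set.ncard_le_ncard (s := (Y : Set G))
            (t := (AddAction.stabilizer G X : Set G)) (fun y hy => hYs y (by simpa using hy))
            (Set.toFinite _)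
          rwa [Set.ncard_coe_finset, ← Nat.card_coe_set_eq] at h
        have h3 : X.card ≤ (X + Y).card :=
          Finset.card_le_card (fun x hx => by simpa using Finset.add_mem_add hx h0)
        nlinarith [Nat.mul_le_mul_left p h2, Nat.mul_le_mul_left p h3]
    · push Not at hst
      obtain ⟨x, hx, y, hy, hxy⟩ := hst
      have hsub := Finset.addDysonETransform.subset x (X, Y)
      have hcard := Finset.addDysonETransform.card x (X, Y)
      simp only [Finset.addDysonETransform] at hsub hcard
      have hlt : (Y ∩ (-x +ᵥ X)).card < c := by
        rw [← hc]
        refine Finset.card_lt_card ⟨Finset.inter_subset_left, fun h => hxy ?_⟩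
        have := Finset.mem_of_mem_inter_right (h hy)
        obtain ⟨z, hz, hzy⟩ := Finset.mem_vadd_finset.1 this
        rw [vadd_eq_add] at hzy
        rw [← hzy]
        simpa using hz
      have h0' : (0 : G) ∈ Y ∩ (-x +ᵥ X) := by
        refine Finset.mem_inter.2 ⟨h0, Finset.mem_vadd_finset.2 ⟨x, hx, by simp⟩⟩
      rcases ih _ hlt (X ∪ (x +ᵥ Y)) (Y ∩ (-x +ᵥ X)) rfl (hX.mono Finset.subset_union_left) h0'
        with h | h
      · left
        rw [h] at hsub
        exact Finset.univ_subset_iff.1 hsub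
      · right
        have h4 := Nat.mul_le_mul_left p (Finset.card_le_card hsub)
        calc _ = p * (X.card + Y.card) := by ring
          _ = _ := by rw [← hcard]; ring
          _ ≤ _ := h
          _ ≤ _ := by omega

open Finset in
theorem card_add_ge {G : Type*} [AddCommGroup G] [Fintype G] [DecidableEq G] (p : ℕ)
    (hH : ∀ H : AddSubgroup G, H ≠ ⊤ → p * Nat.card H ≤ Fintype.card G)
    (X Y : Finset G) (hX : X.Nonempty) (hY : Y.Nonempty) :
    X + Y = univ ∨ p * X.card + p * Y.card ≤ p * (X + Y).card + Fintype.card G := by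
  obtain ⟨y, hy⟩ := hY
  have h := card_add_ge_of_zero_mem p hH _ X (-y +ᵥ Y) rfl hX
    (Finset.mem_vadd_finset.2 ⟨y, hy, by simp⟩)
  have he : X + (-y +ᵥ Y) = -y +ᵥ (X + Y) := by
    rw [← Finset.singleton_vadd, ← Finset.singleton_vadd, vadd_eq_add, vadd_eq_add]
    exact add_left_comm _ _ _
  rw [he] at h
  rcases h with h | h
  · left
    have : (X + Y).card = Fintype.card G := by
      rw [← Finset.card_vadd_finset (-y) (X + Y), h, Finset.card_univ]
    exact (Finset.card_eq_iff_eq_univ _).1 this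
  · right
    simpa using h

theorem AddSubgroup.prime_mul_card_le {G : Type*} [AddCommGroup G] [Fintype G] {p k : ℕ}
    (hp : p.Prime) (hG : Fintype.card G = p ^ k) (H : AddSubgroup G) (hH : H ≠ ⊤) :
    p * Nat.card H ≤ Fintype.card G := by
  have h1 := H.card_mul_index
  rw [Nat.card_eq_fintype_card (α := G), hG] at h1
  have h2 : H.index ∣ p ^ k := ⟨_, by rw [← h1, mul_comm]⟩
  obtain ⟨j, -, hj⟩ := (Nat.dvd_prime_pow hp).1 h2
  have hj0 : j ≠ 0 := by
    rintro rfl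
    exact hH (AddSubgroup.index_eq_one.1 (by simpa using hj))
  have h3 : p ≤ H.index := by
    rw [hj]; exact Nat.le_self_pow hj0 p
  rw [hG, ← h1, mul_comm]
  exact Nat.mul_le_mul_left _ h3

/-- `FreeEps ε A` says that `a + b + c + ε d = e` has no solutions in `A`. -/
def FreeEps {G : Type*} [AddCommGroup G] (ε : ℤ) (A : Set G) : Prop :=
  ∀ a ∈ A, ∀ b ∈ A, ∀ c ∈ A, ∀ d ∈ A, ∀ e ∈ A, a + b + c + ε • d ≠ e

theorem FreeEps.card_add_self_le {G : Type*} [AddCommGroup G] [Fintype G] [DecidableEq G]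
    {p q m : ℕ} {ε : ℤ} (hε : ε = 1 ∨ ε = -1) (hp : p = 5 * m + 3)
    (hH : ∀ H : AddSubgroup G, H ≠ ⊤ → p * Nat.card H ≤ Fintype.card G)
    (hG : Fintype.card G = p * q) {A : Finset G} (hA : A.Nonempty)
    (hfree : FreeEps ε (A : Set G)) (hcard : m * q ≤ A.card) :
    (A + A).card ≤ (2 * m + 2) * q := by
  have hS : (A + A).Nonempty := hA.add hA
  have hcardS : ((A + A).image (fun x => (-ε) • x)).card = (A + A).card := by
    refine Finset.card_image_of_injective _ ?_
    rcases hε with rfl | rfl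
    · intro x y h; simpa using h
    · intro x y h; simpa using h
  have hdisj : Disjoint (A + (A + A).image (fun x => (-ε) • x)) (A + A) := by
    rw [Finset.disjoint_left]
    intro z hz hz'
    obtain ⟨e, he, w, hw, rfl⟩ := Finset.mem_add.1 hz
    obtain ⟨s, hs, rfl⟩ := Finset.mem_image.1 hw
    obtain ⟨c, hc, d, hd, rfl⟩ := Finset.mem_add.1 hs
    obtain ⟨a, ha, b, hb, hab⟩ := Finset.mem_add.1 hz'
    rcases hε with rfl | rfl
    · refine hfree a ha b hb c hc d hd e he ?_
      simp only [one_smul, neg_smul] at hab ⊢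
      rw [hab]; abel
    · refine hfree e he c hc d hd a ha b hb ?_
      simp only [one_smul, neg_neg, neg_smul] at hab ⊢
      rw [add_assoc e, ← hab]; abel
  have hp0 : 0 < p := by omega
  rcases card_add_ge p hH A _ hA (hS.image (fun x => (-ε) • x)) with h | h
  · rw [h] at hdisj
    obtain ⟨x, hx⟩ := hS
    exact absurd hx (Finset.disjoint_left.1 hdisj (Finset.mem_univ x))
  · rw [hcardS, hG] at h
    have h1 : A.card + (A + A).card ≤
        (A + (A + A).image (fun x => (-ε) • x)).card + q := by
      refine Nat.le_of_mul_le_mul_left ?_ hp0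
      rw [mul_add, mul_add]
      exact h
    have h2 : (A + (A + A).image (fun x => (-ε) • x)).card + (A + A).card ≤ p * q := by
      rw [← Finset.card_union_of_disjoint hdisj, ← hG]
      exact Finset.card_le_univ _
    subst hp
    nlinarith

theorem sum_eq_sum_card_filter_lt {ι M : Type*} [AddCommMonoid M] (s : Finset ι) (a : ι → ℕ)
    (q : ℕ) (ha : ∀ i ∈ s, a i ≤ q) (f : ι → M) :
    ∑ i ∈ s, a i • f i = ∑ t ∈ Finset.range q, ∑ i ∈ s with t < a i, f i := by
  simp_rw [Finset.sum_filter]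
  rw [Finset.sum_comm]
  refine Finset.sum_congr rfl fun i hi => ?_
  rw [← Finset.sum_filter, Finset.sum_const]
  congr 1
  have : (Finset.range q).filter (fun t => t < a i) = Finset.range (a i) := by
    ext t
    have := ha i hi
    simp only [Finset.mem_filter, Finset.mem_range]
    omega
  rw [this, Finset.card_range]

theorem sum_eq_sum_card_lt {ι : Type*} (s : Finset ι) (a : ι → ℕ) (q : ℕ)
    (ha : ∀ i ∈ s, a i ≤ q) :
    ∑ i ∈ s, a i = ∑ t ∈ Finset.range q, (s.filter (fun i => t < a i)).card := by
  have := sum_eq_sum_card_filter_lt s a q ha (fun _ => 1)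
  simpa using this

theorem norm_sum_stdAddChar_le {p : ℕ} [Fact p.Prime] (B : Finset (ZMod p)) :
    ‖∑ i ∈ B, (ZMod.stdAddChar i : ℂ)‖ ≤ (min B.card (p - B.card) : ℕ) := by
  have key : ∀ C : Finset (ZMod p), ‖∑ i ∈ C, (ZMod.stdAddChar i : ℂ)‖ ≤ (C.card : ℝ) := by
    intro C
    refine (norm_sum_le _ _).trans ?_
    simp
  have h0 : ∑ i : ZMod p, (ZMod.stdAddChar i : ℂ) = 0 := by
    refine AddChar.sum_eq_zero_of_ne_one fun h => ?_
    have h1 : (ZMod.stdAddChar (1 : ZMod p) : ℂ) = ZMod.stdAddChar (0 : ZMod p) := by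
      rw [h]; simp
    exact one_ne_zero (ZMod.injective_stdAddChar h1)
  rw [Nat.cast_min, le_min_iff]
  refine ⟨key B, ?_⟩
  have h1 : ∑ i ∈ B, (ZMod.stdAddChar i : ℂ) = - ∑ i ∈ Bᶜ, (ZMod.stdAddChar i : ℂ) := by
    rw [eq_neg_iff_add_eq_zero, Finset.sum_add_sum_compl, h0]
  rw [h1, norm_neg]
  refine (key _).trans ?_
  rw [Finset.card_compl, ZMod.card]

/-- The layer of `A` above `i`. -/
def lay {α β : Type*} [DecidableEq α] [DecidableEq β] [Fintype β] (A : Finset (α × β)) (i : α) :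
    Finset β :=
  Finset.univ.filter (fun x => (i, x) ∈ A)

@[simp] theorem mem_lay {α β : Type*} [DecidableEq α] [DecidableEq β] [Fintype β]
    {A : Finset (α × β)} {i : α} {x : β} : x ∈ lay A i ↔ (i, x) ∈ A := by
  simp [lay]

theorem sum_card_lay_smul {α β M : Type*} [DecidableEq α] [DecidableEq β] [Fintype α] [Fintype β]
    [AddCommMonoid M] (A : Finset (α × β)) (f : α → M) :
    ∑ i, (lay A i).card • f i = ∑ x ∈ A, f x.1 := by
  have : ∀ i, (lay A i).card • f i = ∑ y, if (i, y) ∈ A then f i else 0 := by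
    intro i
    rw [← Finset.sum_filter, Finset.sum_const]
    rfl
  simp_rw [this]
  rw [← Fintype.sum_prod_type' (f := fun i y => if (i, y) ∈ A then f i else 0)]
  simp

theorem sum_card_lay {α β : Type*} [DecidableEq α] [DecidableEq β] [Fintype α] [Fintype β]
    (A : Finset (α × β)) : ∑ i, (lay A i).card = A.card := by
  have := sum_card_lay_smul A (fun _ => 1)
  simpa using this

theorem norm_sum_fst_le {W : Type*} [AddCommGroup W] [Fintype W] [DecidableEq W] {p q m h : ℕ}
    [Fact p.Prime]
    (hH : ∀ H : AddSubgroup W, H ≠ ⊤ → p * Nat.card H ≤ Fintype.card W)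
    (hW : Fintype.card W = q) (hq : q = p * h) (A : Finset (ZMod p × W))
    (hcard : m * q ≤ A.card) (hS : (A + A).card ≤ (2 * m + 2) * q)
    (hsmall : ∀ i, 2 * (lay A i).card ≤ q) :
    ‖∑ x ∈ A, (ZMod.stdAddChar x.1 : ℂ)‖ ≤ 2 * q := by
  have hp := (Fact.out : p.Prime)
  set a : ZMod p → ℕ := fun i => (lay A i).card with ha
  set s : ZMod p → ℕ := fun i => (lay (A + A) i).card with hs
  have hpair : ∀ i j, a i ≠ 0 → a j ≠ 0 → a i + a j ≤ s (i + j) + h := by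
    intro i j hi hj
    have hsub : lay A i + lay A j ⊆ lay (A + A) (i + j) := by
      intro z hz
      obtain ⟨x, hx, y, hy, rfl⟩ := Finset.mem_add.1 hz
      rw [mem_lay] at *
      exact Finset.add_mem_add hx hy
    have hle := Finset.card_le_card hsub
    rcases card_add_ge p hH (lay A i) (lay A j) (Finset.card_ne_zero.1 hi)
      (Finset.card_ne_zero.1 hj) with hu | hu
    · rw [hu, Finset.card_univ, hW] at hle
      have h1 := hsmall i
      have h2 := hsmall j
      simp only [ha, hs]
      omega
    · rw [hW, hq] at hu
      have : (lay A i).card + (lay A j).card ≤ (lay A i + lay A j).card + h := by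
        refine Nat.le_of_mul_le_mul_left ?_ hp.pos
        rw [mul_add, mul_add]
        exact hu
      simp only [ha, hs]
      omega
  set u : ZMod p → ℕ := fun i => (s i + h) / 2 with hu
  have hsq : ∀ i, s i ≤ q := fun i => by
    rw [← hW]; exact Finset.card_le_univ _
  have hhq : h ≤ q := by rw [hq]; exact Nat.le_mul_of_pos_left _ hp.pos
  have huq : ∀ i, u i ≤ q := fun i => by
    have := hsq i
    simp only [hu]; omega
  have haq : ∀ i, a i ≤ q := fun i => by
    have := hsmall i
    simp only [ha]; omega
  have hstep : ∀ t, min (Finset.univ.filter (fun i => t < a i)).card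
      (p - (Finset.univ.filter (fun i => t < a i)).card) +
      (Finset.univ.filter (fun i => t < a i)).card ≤
      (Finset.univ.filter (fun i => t < u i)).card + if 2 * t < q then 1 else 0 := by
    intro t
    rcases (Finset.univ.filter (fun i => t < a i)).eq_empty_or_nonempty with h0 | h0
    · simp [h0]
    · have hcd := ZMod.cauchy_davenport hp h0 h0
      have hsub : Finset.univ.filter (fun i => t < a i) + Finset.univ.filter (fun i => t < a i) ⊆
          Finset.univ.filter (fun i => t < u i) := by
        intro z hz
        obtain ⟨x, hx, y, hy, rfl⟩ := Finset.mem_add.1 hz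
        simp only [Finset.mem_filter, Finset.mem_univ, true_and] at *
        have := hpair x y (by omega) (by omega)
        simp only [hu]
        omega
      have hle := Finset.card_le_card hsub
      obtain ⟨i, hi⟩ := h0
      simp only [Finset.mem_filter, Finset.mem_univ, true_and] at hi
      have hi2 := hsmall i
      rw [if_pos (by simp only [ha] at hi; omega)]
      have hfp : (Finset.univ.filter (fun i => t < a i)).card ≤ p :=
        (Finset.card_le_univ _).trans (ZMod.card p).le
      omega
  have hsum := Finset.sum_le_sum (fun t (_ : t ∈ Finset.range q) => hstep t)
  rw [Finset.sum_add_distrib, Finset.sum_add_distrib,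
    ← sum_eq_sum_card_lt _ _ _ (fun i _ => haq i), ← sum_eq_sum_card_lt _ _ _ (fun i _ => huq i)]
    at hsum
  have hA : ∑ i, a i = A.card := sum_card_lay A
  have hSs : ∑ i, s i = (A + A).card := sum_card_lay (A + A)
  have h2u : 2 * ∑ i, u i ≤ (A + A).card + q := by
    rw [Finset.mul_sum]
    calc ∑ i, 2 * u i ≤ ∑ i : ZMod p, (s i + h) :=
          Finset.sum_le_sum fun i _ => by simp only [hu]; omega
      _ = (A + A).card + q := by
          rw [Finset.sum_add_distrib, hSs, hq]; simp
  have hhalf : 2 * ∑ t ∈ Finset.range q, (if 2 * t < q then 1 else 0) ≤ q + 1 := by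
    rw [← Finset.sum_filter, Finset.sum_const, smul_eq_mul, mul_one]
    have : ((Finset.range q).filter (fun t => 2 * t < q)) ⊆ Finset.range ((q + 1) / 2) := by
      intro t ht
      simp only [Finset.mem_filter, Finset.mem_range] at *
      omega
    have := Finset.card_le_card this
    rw [Finset.card_range] at this
    omega
  have hmin : ∑ t ∈ Finset.range q, min (Finset.univ.filter (fun i => t < a i)).card
      (p - (Finset.univ.filter (fun i => t < a i)).card) ≤ 2 * q := by
    have e1 : (2 * m + 2) * q = 2 * (m * q) + 2 * q := by ring
    rw [e1] at hS
    omega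
  have hrw : ∑ x ∈ A, (ZMod.stdAddChar x.1 : ℂ) =
      ∑ t ∈ Finset.range q, ∑ i with t < a i, (ZMod.stdAddChar i : ℂ) := by
    rw [← sum_card_lay_smul A (fun i => (ZMod.stdAddChar i : ℂ)),
      ← sum_eq_sum_card_filter_lt _ _ _ (fun i _ => haq i)]
  rw [hrw]
  calc _ ≤ ∑ t ∈ Finset.range q, ‖∑ i with t < a i, (ZMod.stdAddChar i : ℂ)‖ := norm_sum_le _ _
    _ ≤ ∑ t ∈ Finset.range q, ((min (Finset.univ.filter (fun i => t < a i)).card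
      (p - (Finset.univ.filter (fun i => t < a i)).card) : ℕ) : ℝ) :=
        Finset.sum_le_sum fun t _ => norm_sum_stdAddChar_le _
    _ ≤ 2 * q := by exact_mod_cast hmin

theorem exists_addEquiv_fst_eq_dotProduct {p n : ℕ} [Fact p.Prime] {y : Fin n → ZMod p}
    (hy : y ≠ 0) :
    ∃ e : (Fin n → ZMod p) ≃+ (ZMod p × (Fin (n - 1) → ZMod p)), ∀ x, (e x).1 = y ⬝ᵥ x := by
  obtain ⟨j, hj⟩ := Function.ne_iff.1 hy
  obtain ⟨n, rfl⟩ : ∃ n', n = n' + 1 := ⟨n - 1, by have := j.pos; omega⟩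
  let f : (Fin (n + 1) → ZMod p) →+ (ZMod p × (Fin n → ZMod p)) :=
    { toFun := fun x => (y ⬝ᵥ x, fun i => x (j.succAbove i))
      map_zero' := by ext <;> simp
      map_add' := fun a b => by ext <;> simp [dotProduct_add] }
  have hinj : Function.Injective f := by
    rw [injective_iff_map_eq_zero]
    intro x hx
    have h1 : y ⬝ᵥ x = 0 := congrArg Prod.fst hx
    have h2 : ∀ i, x (j.succAbove i) = 0 := fun i => congrFun (congrArg Prod.snd hx) i
    rw [dotProduct, Fin.sum_univ_succAbove _ j] at h1
    simp only [h2, mul_zero, Finset.sum_const_zero, add_zero] at h1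
    ext i
    rcases Fin.eq_self_or_eq_succAbove j i with rfl | ⟨i', rfl⟩
    · exact (mul_eq_zero.1 h1).resolve_left hj
    · exact h2 i'
  have hbij : Function.Bijective f := by
    rw [Fintype.bijective_iff_injective_and_card]
    refine ⟨hinj, ?_⟩
    simp [ZMod.card, pow_succ, mul_comm]
  exact ⟨AddEquiv.ofBijective f hbij, fun x => rfl⟩

theorem sum_stdAddChar_dotProduct {p n : ℕ} [Fact p.Prime] (x : Fin n → ZMod p) :
    ∑ y : Fin n → ZMod p, (ZMod.stdAddChar (y ⬝ᵥ x) : ℂ) = if x = 0 then (p : ℂ) ^ n else 0 := by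
  split_ifs with hx
  · subst hx
    simp [ZMod.card]
  · obtain ⟨i, hi⟩ := Function.ne_iff.1 hx
    let χ : AddChar (Fin n → ZMod p) ℂ :=
      { toFun := fun y => ZMod.stdAddChar (y ⬝ᵥ x)
        map_zero_eq_one' := by simp
        map_add_eq_mul' := fun a b => by simp [add_dotProduct, AddChar.map_add_eq_mul] }
    change ∑ y, χ y = 0
    refine AddChar.sum_eq_zero_of_ne_one fun h => ?_
    have h1 : (ZMod.stdAddChar (1 : ZMod p) : ℂ) = ZMod.stdAddChar (0 : ZMod p) := by
      have h2 : χ (Pi.single i (x i)⁻¹) = 1 := by rw [h]; simp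
      have h3 : χ (Pi.single i (x i)⁻¹) = ZMod.stdAddChar (Pi.single i (x i)⁻¹ ⬝ᵥ x) := rfl
      rw [h3, single_dotProduct, inv_mul_cancel₀ hi] at h2
      rw [h2]; simp
    exact one_ne_zero (ZMod.injective_stdAddChar h1)

/-- The unnormalised Fourier transform of the indicator function of `X`. -/
noncomputable def fourierSum {p n : ℕ} [NeZero p] (X : Finset (Fin n → ZMod p))
    (y : Fin n → ZMod p) : ℂ :=
  ∑ x ∈ X, ZMod.stdAddChar (y ⬝ᵥ x)

theorem sum_norm_fourierSum_sq {p n : ℕ} [Fact p.Prime] (X : Finset (Fin n → ZMod p)) :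
    ∑ y, ‖fourierSum X y‖ ^ 2 = (p : ℝ) ^ n * X.card := by
  have h : (((∑ y, ‖fourierSum X y‖ ^ 2 : ℝ)) : ℂ) = (p : ℂ) ^ n * X.card := by
    push_cast
    calc ∑ y, ((‖fourierSum X y‖ : ℂ)) ^ 2
        = ∑ y, ∑ a ∈ X, ∑ b ∈ X, (ZMod.stdAddChar (y ⬝ᵥ (a - b)) : ℂ) := by
          refine Finset.sum_congr rfl fun y _ => ?_
          rw [← Complex.mul_conj', fourierSum, map_sum, Finset.sum_mul_sum]
          refine Finset.sum_congr rfl fun a _ => Finset.sum_congr rfl fun b _ => ?_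
          rw [← AddChar.map_neg_eq_conj, ← AddChar.map_add_eq_mul, dotProduct_sub, sub_eq_add_neg]
      _ = ∑ a ∈ X, ∑ b ∈ X, if a = b then (p : ℂ) ^ n else 0 := by
          rw [Finset.sum_comm]
          refine Finset.sum_congr rfl fun a _ => ?_
          rw [Finset.sum_comm]
          refine Finset.sum_congr rfl fun b _ => ?_
          rw [sum_stdAddChar_dotProduct]
          simp [sub_eq_zero]
      _ = _ := by
          simp [mul_comm]
  exact_mod_cast h

theorem sum_fourierSum_sq_mul_conj {p n : ℕ} [Fact p.Prime] (A : Finset (Fin n → ZMod p)) :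
    ∑ y, fourierSum A y * fourierSum A y * (starRingEnd ℂ) (fourierSum (A + A) y) =
      (p : ℂ) ^ n * A.card ^ 2 := by
  calc _ = ∑ y, ∑ a ∈ A, ∑ b ∈ A, ∑ s ∈ A + A, (ZMod.stdAddChar (y ⬝ᵥ (a + b - s)) : ℂ) := by
          refine Finset.sum_congr rfl fun y _ => ?_
          simp only [fourierSum]
          rw [map_sum, Finset.sum_mul_sum, Finset.sum_mul]
          refine Finset.sum_congr rfl fun a _ => ?_
          rw [Finset.sum_mul_sum]
          refine Finset.sum_congr rfl fun b _ => Finset.sum_congr rfl fun s _ => ?_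
          rw [← AddChar.map_neg_eq_conj, ← AddChar.map_add_eq_mul, ← AddChar.map_add_eq_mul,
            dotProduct_sub, dotProduct_add, sub_eq_add_neg]
    _ = ∑ a ∈ A, ∑ b ∈ A, ∑ s ∈ A + A, if a + b = s then (p : ℂ) ^ n else 0 := by
          rw [Finset.sum_comm]
          refine Finset.sum_congr rfl fun a _ => ?_
          rw [Finset.sum_comm]
          refine Finset.sum_congr rfl fun b _ => ?_
          rw [Finset.sum_comm]
          refine Finset.sum_congr rfl fun s _ => ?_
          rw [sum_stdAddChar_dotProduct]
          simp [sub_eq_zero]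
    _ = ∑ a ∈ A, ∑ b ∈ A, (p : ℂ) ^ n := by
          refine Finset.sum_congr rfl fun a ha => Finset.sum_congr rfl fun b hb => ?_
          rw [Finset.sum_ite_eq, if_pos (Finset.add_mem_add ha hb)]
    _ = _ := by
          simp; ring

theorem exists_big_fourierSum {p n q m : ℕ} [Fact p.Prime] (hp : p = 5 * m + 3) (hm : 21 ≤ m)
    (hq0 : 0 < q) (hq : p ^ n = p * q) (A : Finset (Fin n → ZMod p)) (hcard : m * q ≤ A.card)
    (hS : (A + A).card ≤ (2 * m + 2) * q) :
    ∃ y : Fin n → ZMod p, y ≠ 0 ∧ 2 * (q : ℝ) < ‖fourierSum A y‖ := by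
  by_contra! hcon
  have h1 : ∀ y, y ≠ 0 →
      ‖fourierSum A y * fourierSum A y * (starRingEnd ℂ) (fourierSum (A + A) y)‖ ≤
        q * (‖fourierSum A y‖ ^ 2 + ‖fourierSum (A + A) y‖ ^ 2) := by
    intro y hy
    rw [norm_mul, norm_mul, RCLike.norm_conj]
    have h2 := hcon y hy
    have h3 := norm_nonneg (fourierSum A y)
    have h4 := norm_nonneg (fourierSum (A + A) y)
    have h5 : (0 : ℝ) ≤ q := Nat.cast_nonneg _
    have h6 := mul_le_mul_of_nonneg_right h2 (mul_nonneg h3 h4)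
    nlinarith [mul_nonneg h5 (sq_nonneg (‖fourierSum A y‖ - ‖fourierSum (A + A) y‖))]
  have h0 : ∀ X : Finset (Fin n → ZMod p), fourierSum X 0 = X.card := by
    intro X; simp [fourierSum]
  have h2 : (p : ℝ) ^ n * (A.card : ℝ) ^ 2 ≤ (A.card : ℝ) ^ 2 * (A + A).card +
      q * ((p : ℝ) ^ n * A.card + (p : ℝ) ^ n * (A + A).card) := by
    have h3 := congrArg norm (sum_fourierSum_sq_mul_conj A)
    rw [← Finset.add_sum_erase _ _ (Finset.mem_univ 0)] at h3
    have h4 : ‖(p : ℂ) ^ n * A.card ^ 2‖ = (p : ℝ) ^ n * (A.card : ℝ) ^ 2 := by simp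
    rw [h4] at h3
    rw [← h3]
    refine (norm_add_le _ _).trans (add_le_add ?_ ?_)
    · rw [h0, h0]; simp [sq]
    · refine (norm_sum_le _ _).trans ?_
      calc _ ≤ ∑ y ∈ Finset.univ.erase (0 : Fin n → ZMod p),
            q * (‖fourierSum A y‖ ^ 2 + ‖fourierSum (A + A) y‖ ^ 2) :=
            Finset.sum_le_sum fun y hy => h1 y (Finset.ne_of_mem_erase hy)
        _ ≤ ∑ y, q * (‖fourierSum A y‖ ^ 2 + ‖fourierSum (A + A) y‖ ^ 2) :=
            Finset.sum_le_sum_of_subset_of_nonneg (Finset.subset_univ _)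
              fun _ _ _ => by positivity
        _ = _ := by
            rw [← Finset.mul_sum, Finset.sum_add_distrib, sum_norm_fourierSum_sq,
              sum_norm_fourierSum_sq]
  have h3 : p ^ n * A.card ^ 2 ≤ A.card ^ 2 * (A + A).card +
      q * (p ^ n * A.card + p ^ n * (A + A).card) := by exact_mod_cast h2
  rw [hq] at h3
  set a := A.card with ha
  set s := (A + A).card with hs
  have h4 : s ≤ 3 * a := by nlinarith
  have h5 : q * (p * a ^ 2) ≤ q * (a ^ 2 * (2 * m + 2) + p * q * (4 * a)) := by
    have e1 : a ^ 2 * s ≤ a ^ 2 * ((2 * m + 2) * q) := Nat.mul_le_mul_left _ hS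
    have e2 : q * (p * q * a + p * q * s) ≤ q * (p * q * a + p * q * (3 * a)) :=
      Nat.mul_le_mul_left _ (Nat.add_le_add_left (Nat.mul_le_mul_left _ h4) _)
    nlinarith
  have h6 := Nat.le_of_mul_le_mul_left h5 hq0
  have ha0 : 0 < a := by
    have : 0 < m * q := Nat.mul_pos (by omega) hq0
    omega
  have h7 : a * (p * a) ≤ a * (a * (2 * m + 2) + p * q * 4) := by nlinarith
  have h8 := Nat.le_of_mul_le_mul_left h7 ha0
  have h9 : a * (3 * m + 1) ≤ 4 * (5 * m + 3) * q := by subst hp; nlinarith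
  have h10 : (m * (3 * m + 1)) * q ≤ (4 * (5 * m + 3)) * q := by nlinarith
  have h11 := Nat.le_of_mul_le_mul_right h10 hq0
  nlinarith

/-- Some coordinate projection of `A` has a fibre which is more than half full. -/
theorem exists_addEquiv_big_layer {p n m : ℕ} [Fact p.Prime] (hp : p = 5 * m + 3) (hm : 21 ≤ m)
    (hn : 1 ≤ n) (A : Finset (Fin n → ZMod p)) (hcard : m * p ^ (n - 1) ≤ A.card)
    (hS : (A + A).card ≤ (2 * m + 2) * p ^ (n - 1)) :
    ∃ (e : (Fin n → ZMod p) ≃+ (ZMod p × (Fin (n - 1) → ZMod p))) (i : ZMod p),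
      p ^ (n - 1) < 2 * (lay (A.map e.toEquiv.toEmbedding) i).card := by
  have hpp := (Fact.out : p.Prime)
  have hq0 : 0 < p ^ (n - 1) := pow_pos hpp.pos _
  have hq : p ^ n = p * p ^ (n - 1) := by
    rw [← pow_succ', Nat.sub_add_cancel hn]
  obtain ⟨y, hy, hbig⟩ := exists_big_fourierSum hp hm hq0 hq A hcard hS
  obtain ⟨e, he⟩ := exists_addEquiv_fst_eq_dotProduct hy
  refine ⟨e, ?_⟩
  by_contra! hcon
  refine absurd hbig (not_lt.2 ?_)
  set A' := A.map e.toEquiv.toEmbedding with hA'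
  have hcA : A'.card = A.card := Finset.card_map _
  have hadd : A' + A' = (A + A).map e.toEquiv.toEmbedding := by
    ext z
    simp only [hA', Finset.mem_add, Finset.mem_map]
    constructor
    · rintro ⟨_, ⟨a, ha, rfl⟩, _, ⟨b, hb, rfl⟩, rfl⟩
      exact ⟨a + b, ⟨a, ha, b, hb, rfl⟩, map_add e a b⟩
    · rintro ⟨_, ⟨a, ha, b, hb, rfl⟩, rfl⟩
      exact ⟨_, ⟨a, ha, rfl⟩, _, ⟨b, hb, rfl⟩, (map_add e a b).symm⟩
  have hcS : (A' + A').card = (A + A).card := by rw [hadd]; exact Finset.card_map _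
  have hF : fourierSum A y = ∑ x ∈ A', (ZMod.stdAddChar x.1 : ℂ) := by
    rw [hA', Finset.sum_map]
    exact Finset.sum_congr rfl fun x _ => congrArg _ (he x).symm
  rw [hF]
  have hW : Fintype.card (Fin (n - 1) → ZMod p) = p ^ (n - 1) := by simp [ZMod.card]
  obtain ⟨h, hh⟩ | hn1 : (∃ h, p ^ (n - 1) = p * h) ∨ n = 1 := by
    rcases Nat.lt_or_ge 1 n with h | h
    · exact Or.inl ⟨p ^ (n - 2), by rw [← pow_succ']; congr 1; omega⟩
    · exact Or.inr (by omega)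
  · exact_mod_cast norm_sum_fst_le (m := m)
      (fun H hH => AddSubgroup.prime_mul_card_le hpp hW H hH) hW hh A'
      (by rw [hcA]; exact hcard) (by rw [hcS]; exact hS) hcon
  · exfalso
    have h0 : ∑ i, (lay A' i).card = 0 := by
      refine Finset.sum_eq_zero fun i _ => ?_
      have := hcon i
      have h1 : p ^ (n - 1) = 1 := by rw [hn1]; simp
      omega
    rw [sum_card_lay, hcA] at h0
    have : 0 < m * p ^ (n - 1) := Nat.mul_pos (by omega) hq0
    omega

/-- The system of inequalities satisfied by the layer sizes of a `FreeEps ε` set. -/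
structure LayerSizes {p : ℕ} (ε : ℤ) (q m : ℕ) (a : ZMod p → ℕ) [NeZero p] : Prop where
  le : ∀ i, a i ≤ q
  sum_ge : m * q ≤ ∑ i, a i
  pair : ∀ i₁ i₂ i₃ i₄, a i₂ ≠ 0 → a i₃ ≠ 0 → a i₄ ≠ 0 →
    a i₁ + a (i₁ + (i₂ + i₃ + ε • i₄)) ≤ q

theorem LayerSizes.card_big_ge {p : ℕ} [Fact p.Prime] {ε : ℤ} (hε : ε = 1 ∨ ε = -1) {q m : ℕ}
    {a : ZMod p → ℕ} (ha : LayerSizes ε q m a) (hp : p = 5 * m + 3) (hm : 21 ≤ m) (hq : Odd q)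
    (i₀ : ZMod p) (hi₀ : q < 2 * a i₀) :
    m ≤ (Finset.univ.filter (fun i => q < 2 * a i)).card := by
  have hpp := (Fact.out : p.Prime)
  set S : Finset (ZMod p) := Finset.univ.filter (fun i => a i ≠ 0) with hS
  set f : ℕ → Finset (ZMod p) := fun t => Finset.univ.filter (fun i => t < a i) with hf
  set T := S + S + S.image (fun x => ε • x) with hT
  have hS0 : S.Nonempty := ⟨i₀, by
    simp only [hS, Finset.mem_filter, Finset.mem_univ, true_and]; omega⟩
  have hST : ∀ i, ∀ τ ∈ T, a i + a (i + τ) ≤ q := by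
    intro i τ hτ
    obtain ⟨x, hx, y, hy, rfl⟩ := Finset.mem_add.1 hτ
    obtain ⟨i₂, h₂, i₃, h₃, rfl⟩ := Finset.mem_add.1 hx
    obtain ⟨i₄, h₄, rfl⟩ := Finset.mem_image.1 hy
    simp only [hS, Finset.mem_filter, Finset.mem_univ, true_and] at h₂ h₃ h₄
    exact ha.pair _ _ _ _ h₂ h₃ h₄
  have hSε : (S.image (fun x => ε • x)).card = S.card := by
    refine Finset.card_image_of_injective _ ?_
    rcases hε with rfl | rfl
    · intro x y h; simpa using h
    · intro x y h; simpa using h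
  have hT0 : (0 : ZMod p) ∉ T := fun h => by
    have := hST i₀ 0 h
    rw [add_zero] at this
    omega
  have hTlt : T.card < p := by
    refine lt_of_lt_of_eq ?_ (Finset.card_univ.trans (ZMod.card p))
    exact Finset.card_lt_card ((Finset.ssubset_univ_iff).2 fun h => hT0 (h ▸ Finset.mem_univ _))
  have hN : 3 * S.card ≤ T.card + 2 := by
    have h1 := ZMod.cauchy_davenport hpp hS0 hS0
    have h2 := ZMod.cauchy_davenport hpp (hS0.add hS0) (hS0.image (fun x => ε • x))
    rw [hSε, ← hT] at h2
    have h3 := hS0.card_pos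
    omega
  have hff : ∀ t, t < q → (f t).Nonempty → (f (q - 1 - t)).Nonempty →
      3 * S.card + (f t).card + (f (q - 1 - t)).card ≤ 5 * m + 6 := by
    intro t ht h1 h2
    have hdisj : Disjoint T (f (q - 1 - t) + (f t).image (fun x => -x)) := by
      rw [Finset.disjoint_left]
      intro τ hτ hτ'
      obtain ⟨j, hj, y, hy, rfl⟩ := Finset.mem_add.1 hτ'
      obtain ⟨i, hi, rfl⟩ := Finset.mem_image.1 hy
      simp only [hf, Finset.mem_filter, Finset.mem_univ, true_and] at hj hi
      have := hST i _ hτ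
      rw [show i + (j + -i) = j by ring] at this
      omega
    have h3 : T.card + (f (q - 1 - t) + (f t).image (fun x => -x)).card ≤ p := by
      rw [← Finset.card_union_of_disjoint hdisj]
      exact (Finset.card_le_univ _).trans (ZMod.card p).le
    have h4 := ZMod.cauchy_davenport hpp h2 (h1.image (fun x => -x))
    rw [Finset.card_image_of_injective _ neg_injective] at h4
    have h5 := h1.card_pos
    have h6 := h2.card_pos
    have h7 : 0 < T.card := ((hS0.add hS0).add (hS0.image _)).card_pos
    omega
  obtain ⟨c, hc⟩ := hq
  have hb : Finset.univ.filter (fun i => q < 2 * a i) = f c := by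
    ext i
    simp only [hf, Finset.mem_filter, Finset.mem_univ, true_and]
    omega
  rw [hb]
  by_contra hlt
  have hfc : (f c).Nonempty := ⟨i₀, by
    simp only [hf, Finset.mem_filter, Finset.mem_univ, true_and]; omega⟩
  have hcc : q - 1 - c = c := by omega
  have hmid := hff c (by omega) hfc (by rwa [hcc])
  rw [hcc] at hmid
  have hfS : ∀ t, (f t).card ≤ S.card := fun t => Finset.card_le_card fun i hi => by
    simp only [hf, hS, Finset.mem_filter, Finset.mem_univ, true_and] at *
    omega
  have hanti : ∀ t, c ≤ t → (f t).card ≤ (f c).card := fun t ht =>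
    Finset.card_le_card fun i hi => by
      simp only [hf, Finset.mem_filter, Finset.mem_univ, true_and] at *
      omega
  have hfc1 := hfc.card_pos
  have hle : ∀ t ∈ Finset.range q, (f t).card + (f (q - 1 - t)).card ≤ 2 * m := by
    intro t ht
    rw [Finset.mem_range] at ht
    have e1 := hfS t
    have e2 := hfS (q - 1 - t)
    rcases (f t).eq_empty_or_nonempty with h1 | h1
    · rw [h1, Finset.card_empty]; omega
    rcases (f (q - 1 - t)).eq_empty_or_nonempty with h2 | h2
    · rw [h2, Finset.card_empty]; omega
    have e3 := hff t ht h1 h2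
    rcases le_total c t with h3 | h3
    · have := hanti t h3; omega
    · have := hanti (q - 1 - t) (by omega); omega
  have hsum : ∑ t ∈ Finset.range q, ((f t).card + (f (q - 1 - t)).card) <
      ∑ t ∈ Finset.range q, 2 * m :=
    Finset.sum_lt_sum hle ⟨c, Finset.mem_range.2 (by omega), by rw [hcc]; omega⟩
  rw [Finset.sum_add_distrib, Finset.sum_range_reflect (fun t => (f t).card), Finset.sum_const,
    Finset.card_range, smul_eq_mul, ← sum_eq_sum_card_lt _ _ _ (fun i _ => ha.le i)] at hsum
  have := ha.sum_ge
  nlinarith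

theorem LayerSizes.exists_progression {p : ℕ} [Fact p.Prime] {ε : ℤ} (hε : ε = 1 ∨ ε = -1)
    {q m : ℕ} {a : ZMod p → ℕ} (ha : LayerSizes ε q m a) (hp : p = 5 * m + 3) (hm : 21 ≤ m)
    (hq : Odd q) {τ : ℝ} (hτ0 : 0 < τ) (hfeas : Feasible (1 / 5 : ℝ) τ) (hm1 : 5 / τ ≤ (m : ℝ))
    (i₀ : ZMod p) (hi₀ : q < 2 * a i₀) :
    ∃ (B : Finset (ZMod p)) (y d : ZMod p), d ≠ 0 ∧ B.card = m ∧ (∀ x ∈ B, q < 2 * a x) ∧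
      ∀ x ∈ B, ∃ i : ℕ, i ≤ m + 2 ∧ x = y + i * d := by
  have hpp := (Fact.out : p.Prime)
  obtain ⟨B, hBsub, hBcard⟩ := Finset.exists_subset_card_eq (ha.card_big_ge hε hp hm hq i₀ hi₀)
  have hB : ∀ x ∈ B, q < 2 * a x := fun x hx => by simpa using hBsub hx
  have hfree : FreeEps ε (B : Set (ZMod p)) := by
    intro x hx y hy z hz w hw v hv h
    have h1 := hB x hx
    have h2 := hB y hy
    have h3 := hB z hz
    have h4 := hB w hw
    have h5 := hB v hv
    have h6 := ha.pair x y z w (by omega) (by omega) (by omega)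
    rw [← add_assoc, ← add_assoc, h] at h6
    omega
  have hB0 : B.Nonempty := Finset.card_pos.1 (by omega)
  have h2B : (B + B).card ≤ 2 * m + 2 := by
    have := hfree.card_add_self_le (q := 1) (m := m) hε hp
      (fun H hH => AddSubgroup.prime_mul_card_le (k := 1) hpp (by simp [ZMod.card]) H hH)
      (by simp [ZMod.card]) hB0 (by omega)
    omega
  have hτm : 5 ≤ τ * m := by
    rw [div_le_iff₀ hτ0] at hm1
    linarith
  have hn1 : ((B : Set (ZMod p))).ncard = m := by rw [Set.ncard_coe_finset, hBcard]
  have hn2 : ((B : Set (ZMod p)) + (B : Set (ZMod p))).ncard = (B + B).card := by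
    rw [← Finset.coe_add, Set.ncard_coe_finset]
  obtain ⟨y, d, hd, hsub⟩ := hfeas p hpp (B : Set (ZMod p))
    (by rw [hn1, hp]; push_cast; linarith)
    (by
      rw [hn1, hn2]
      have : ((B + B).card : ℝ) ≤ 2 * m + 2 := by exact_mod_cast h2B
      linarith)
  refine ⟨B, y, d, hd, hBcard, hB, fun x hx => ?_⟩
  obtain ⟨i, hi, hxi⟩ := hsub hx
  rw [hn1, hn2] at hi
  exact ⟨i, by omega, hxi⟩

theorem LayerSizes.dilate {p : ℕ} [Fact p.Prime] {ε : ℤ} {q m : ℕ} {a : ZMod p → ℕ}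
    (ha : LayerSizes ε q m a) {d : ZMod p} (hd : d ≠ 0) :
    LayerSizes ε q m (fun x => a (d * x)) where
  le i := ha.le _
  sum_ge := by
    rw [Fintype.sum_equiv (Equiv.mulLeft₀ d hd) (fun x => a (d * x)) a (fun x => rfl)]
    exact ha.sum_ge
  pair i₁ i₂ i₃ i₄ h₂ h₃ h₄ := by
    have := ha.pair (d * i₁) _ _ _ h₂ h₃ h₄
    rwa [← mul_smul_comm, ← mul_add, ← mul_add, ← mul_add] at this

theorem exists_hull {p : ℕ} (P : ZMod p → Prop) (y : ZMod p) (L : ℕ)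
    (h : ∃ i : ℕ, i ≤ L ∧ P (y + i)) :
    ∃ i₀ L' : ℕ, i₀ + L' ≤ L ∧ P (y + i₀) ∧ P (y + i₀ + L') ∧
      ∀ i ≤ L, P (y + i) → i₀ ≤ i ∧ i ≤ i₀ + L' := by
  classical
  set I := (Finset.range (L + 1)).filter (fun i : ℕ => P (y + i)) with hI
  have hI0 : I.Nonempty := by
    obtain ⟨i, hi, hP⟩ := h
    exact ⟨i, by simp only [hI, Finset.mem_filter, Finset.mem_range]; exact ⟨by omega, hP⟩⟩
  have h1 := I.min'_mem hI0
  have h2 := I.max'_mem hI0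
  have h3 := I.min'_le_max' hI0
  set i₀ := I.min' hI0 with hi₀
  set i₁ := I.max' hI0 with hi₁
  have h1' := h1
  have h2' := h2
  simp only [hI, Finset.mem_filter, Finset.mem_range] at h1' h2'
  refine ⟨i₀, i₁ - i₀, by omega, h1'.2, ?_, fun i hi hP => ?_⟩
  · rw [add_assoc, ← Nat.cast_add, Nat.add_sub_cancel' h3]
    exact h2'.2
  · have hiI : i ∈ I := by
      simp only [hI, Finset.mem_filter, Finset.mem_range]; exact ⟨by omega, hP⟩
    have := I.min'_le i hiI
    have := I.le_max' i hiI
    omega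

theorem exists_add_mem_of_card {I : Finset ℕ} {L m δ : ℕ} (hI : I ⊆ Finset.range (L + 1))
    (hc : m ≤ I.card) (hδ : δ + L + 2 ≤ 2 * m) : ∃ i ∈ I, i + δ ∈ I := by
  by_contra! hcon
  have hdisj : Disjoint I (I.image (· + δ)) := by
    rw [Finset.disjoint_left]
    intro x hx hx'
    obtain ⟨i, hi, rfl⟩ := Finset.mem_image.1 hx'
    exact hcon i hi hx
  have h1 : I ∪ I.image (· + δ) ⊆ Finset.range (L + 1 + δ) := by
    intro x hx
    rcases Finset.mem_union.1 hx with h | h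
    · have := Finset.mem_range.1 (hI h)
      exact Finset.mem_range.2 (by omega)
    · obtain ⟨i, hi, rfl⟩ := Finset.mem_image.1 h
      have := Finset.mem_range.1 (hI hi)
      exact Finset.mem_range.2 (by omega)
  have h2 := Finset.card_le_card h1
  rw [Finset.card_union_of_disjoint hdisj, Finset.card_range,
    Finset.card_image_of_injective _ (add_left_injective δ)] at h2
  omega

theorem ne_intCast_of_pair_le {p q L m : ℕ} {a : ZMod p → ℕ} {y τ : ZMod p}
    (hB : m ≤ ((Finset.range (L + 1)).filter (fun i : ℕ => q < 2 * a (y + i))).card)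
    (hτ : ∀ i, a i + a (i + τ) ≤ q) (δ : ℤ) (hδ : |δ| + L + 2 ≤ 2 * m) : τ ≠ (δ : ZMod p) := by
  rintro rfl
  obtain ⟨e, he⟩ := Int.eq_nat_or_neg δ
  have he' : |δ| = e := by rcases he with rfl | rfl <;> simp
  obtain ⟨i, hi, hi'⟩ := exists_add_mem_of_card (δ := e) (Finset.filter_subset _ _) hB (by omega)
  have h1 := (Finset.mem_filter.1 hi).2
  have h2 := (Finset.mem_filter.1 hi').2
  rcases he with rfl | rfl
  · have h3 := hτ (y + i)
    rw [Int.cast_natCast, add_assoc, ← Nat.cast_add] at h3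
    omega
  · have h3 := hτ (y + ((i + e : ℕ) : ZMod p))
    rw [Int.cast_neg, Int.cast_natCast,
      show y + ((i + e : ℕ) : ZMod p) + -(e : ZMod p) = y + i by push_cast; ring] at h3
    omega

theorem exists_natCast_of_gaps {p R K L : ℕ} [NeZero p] {ρ : ZMod p} (hL : L ≤ 2 * R + 1)
    (h : ∀ u : ℕ, u ≤ K → ∀ δ : ℤ, |δ| ≤ R → ρ + u * L ≠ (δ : ZMod p)) :
    ∃ r : ℕ, ρ = r ∧ R + 1 ≤ r ∧ r + R + K * L + 1 ≤ p := by
  have hr : ρ = (ρ.val : ZMod p) := (ZMod.natCast_zmod_val ρ).symm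
  have hlt := ZMod.val_lt ρ
  refine ⟨ρ.val, hr, ?_, ?_⟩
  · by_contra hcon
    refine h 0 (Nat.zero_le _) ρ.val (by rw [abs_of_nonneg (by positivity)]; omega) ?_
    simp
  · by_contra hcon
    have hex : ∃ u, p - ρ.val ≤ R + u * L := ⟨K, by omega⟩
    classical
    have hspec := Nat.find_spec hex
    have hK : Nat.find hex ≤ K := Nat.find_min' hex (by omega)
    set u := Nat.find hex with hu
    have hlow : u * L ≤ R + (p - ρ.val) := by
      rcases Nat.eq_zero_or_pos u with h0 | h0
      · rw [h0]; omega
      · have := Nat.find_min hex (m := u - 1) (by omega)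
        obtain ⟨v, hv⟩ : ∃ v, u = v + 1 := ⟨u - 1, by omega⟩
        rw [hv, Nat.add_sub_cancel] at this
        rw [hv, add_mul, one_mul]
        omega
    refine h u hK ((u * L : ℕ) - ((p - ρ.val : ℕ) : ℤ)) (by rw [abs_le]; omega) ?_
    rw [Nat.cast_sub hlt.le]
    push_cast
    rw [ZMod.natCast_self, ← hr]
    ring

theorem sum_range_le_of_pair {α : ℕ → ℕ} {q N w : ℕ} (hα : ∀ i, α i ≤ q) (hw : 2 * w ≤ N)
    (hpair : ∀ i < w, α i + α (i + (N - w)) ≤ q) : ∑ i ∈ Finset.range N, α i ≤ (N - w) * q := by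
  obtain ⟨M, rfl⟩ : ∃ M, N = w + M + w := ⟨N - 2 * w, by omega⟩
  have e : w + M + w - w = w + M := by omega
  rw [e] at hpair ⊢
  rw [Finset.sum_range_add, Finset.sum_range_add]
  have h1 : ∑ i ∈ Finset.range M, α (w + i) ≤ M * q := by
    refine (Finset.sum_le_sum fun i _ => hα (w + i)).trans ?_
    simp
  have h2 : ∑ i ∈ Finset.range w, (α i + α (w + M + i)) ≤ w * q := by
    refine (Finset.sum_le_sum fun i hi => ?_).trans (b := ∑ i ∈ Finset.range w, q) (by simp)
    rw [add_comm (w + M) i]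
    exact hpair i (Finset.mem_range.1 hi)
  rw [Finset.sum_add_distrib] at h2
  nlinarith

theorem five_mul_add_three_eq_zero {p m : ℕ} (hp : p = 5 * m + 3) :
    5 * (m : ZMod p) + 3 = 0 := by
  have h : ((5 * m + 3 : ℕ) : ZMod p) = 0 := (ZMod.natCast_eq_zero_iff _ _).2 hp.dvd
  exact_mod_cast h

/-- The structural information extracted from the layer sizes: after dilating by `d`, the support
is contained in `[y, y + L]`. -/
structure LayerHull {p : ℕ} (ε : ℤ) (m : ℕ) (a : ZMod p → ℕ) (d y : ZMod p) (L : ℕ) (w : ℤ) :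
    Prop where
  d_ne : d ≠ 0
  supp : ∀ x, a (d * x) ≠ 0 → ∃ i : ℕ, i ≤ L ∧ x = y + i
  left : a (d * y) ≠ 0
  right : a (d * (y + L)) ≠ 0
  le : m ≤ L + 1
  le' : L ≤ m + 1
  w_le : w ≤ L + 1 - m
  w_ge : 5 * ((L : ℤ) - m) - 1 ≤ 2 * w
  eq : (ε = 1 ∧ 3 * y = ((w - 4 * L - 1 : ℤ) : ZMod p)) ∨
    (ε = -1 ∧ y = ((w - 3 * L - 1 : ℤ) : ZMod p))

theorem LayerSizes.localise {p : ℕ} [Fact p.Prime] {ε : ℤ} (hε : ε = 1 ∨ ε = -1)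
    {q m : ℕ} {a : ZMod p → ℕ} (ha : LayerSizes ε q m a) (hp : p = 5 * m + 3) (hm : 21 ≤ m)
    {y : ZMod p} (hB : m ≤ ((Finset.range (m + 2 + 1)).filter
      (fun i : ℕ => q < 2 * a (y + i))).card) :
    ∃ κ : ZMod p, ∀ x, a x ≠ 0 → ∃ i : ℕ, i ≤ m + 5 ∧ x = κ + i := by
  obtain ⟨i₀, L, hL, h₀, h₁, hall⟩ := exists_hull (fun x => q < 2 * a x) y (m + 2) (by
    have : 0 < ((Finset.range (m + 2 + 1)).filter (fun i : ℕ => q < 2 * a (y + i))).card := by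
      omega
    obtain ⟨i, hi⟩ := Finset.card_pos.1 this
    rw [Finset.mem_filter, Finset.mem_range] at hi
    exact ⟨i, by omega, hi.2⟩)
  have hB' : m ≤ ((Finset.range (L + 1)).filter (fun i : ℕ => q < 2 * a (y + i₀ + i))).card := by
    refine hB.trans (Finset.card_le_card_of_injOn (fun i => i - i₀) ?_ ?_)
    · intro i hi
      rw [Finset.mem_coe, Finset.mem_filter, Finset.mem_range] at hi
      obtain ⟨h1, h2⟩ := hall i (by omega) hi.2
      rw [Finset.mem_coe, Finset.mem_filter, Finset.mem_range]
      refine ⟨by dsimp only; omega, ?_⟩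
      rw [add_assoc, ← Nat.cast_add, Nat.add_sub_cancel' h1]
      exact hi.2
    · intro i hi j hj hij
      rw [Finset.mem_coe, Finset.mem_filter, Finset.mem_range] at hi hj
      obtain ⟨h1, h2⟩ := hall i (by omega) hi.2
      obtain ⟨h3, h4⟩ := hall j (by omega) hj.2
      simp only at hij
      omega
  set y₁ := y + i₀ with hy₁
  have hn₀ : a y₁ ≠ 0 := by omega
  have hn₁ : a (y₁ + L) ≠ 0 := by omega
  have hLm : m ≤ L + 1 := by
    refine hB'.trans ((Finset.card_filter_le _ _).trans ?_)
    simp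
  obtain ⟨R, hR⟩ : ∃ R, R + L + 2 = 2 * m := ⟨2 * m - L - 2, by omega⟩
  have hgap : ∀ ρ : ZMod p, (∀ u : ℕ, u ≤ 2 → ∀ i, a i + a (i + (ρ + u * L)) ≤ q) →
      ∃ i : ℕ, i ≤ m + 5 ∧ ρ = ((R + 1 : ℕ) : ZMod p) + i := by
    intro ρ hρ
    obtain ⟨r, hr, hr1, hr2⟩ := exists_natCast_of_gaps (p := p) (R := R) (K := 2) (L := L) (ρ := ρ)
      (by omega) (fun u hu δ hδ => ne_intCast_of_pair_le hB' (hρ u hu) δ (by omega))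
    refine ⟨r - (R + 1), by omega, ?_⟩
    rw [← Nat.cast_add, Nat.add_sub_cancel' hr1, hr]
  rcases hε with rfl | rfl
  · refine ⟨((R + 1 : ℕ) : ZMod p) - 2 * y₁, fun x hx => ?_⟩
    obtain ⟨i, hi, h⟩ := hgap (x + 2 * y₁) (by
      intro u hu i
      interval_cases u
      · have := ha.pair i x y₁ y₁ hx hn₀ hn₀
        rw [one_smul] at this
        convert this using 4; push_cast; ring
      · have := ha.pair i x y₁ (y₁ + L) hx hn₀ hn₁
        rw [one_smul] at this
        convert this using 4; push_cast; ring
      · have := ha.pair i x (y₁ + L) (y₁ + L) hx hn₁ hn₁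
        rw [one_smul] at this
        convert this using 4; push_cast; ring)
    exact ⟨i, hi, by linear_combination h⟩
  · refine ⟨((R + 1 : ℕ) : ZMod p) + L, fun x hx => ?_⟩
    obtain ⟨i, hi, h⟩ := hgap (x - L) (by
      intro u hu i
      interval_cases u
      · have := ha.pair i x y₁ (y₁ + L) hx hn₀ hn₁
        rw [neg_smul, one_smul] at this
        convert this using 4; push_cast; ring
      · have := ha.pair i x y₁ y₁ hx hn₀ hn₀
        rw [neg_smul, one_smul] at this
        convert this using 4; push_cast; ring
      · have := ha.pair i x (y₁ + L) y₁ hx hn₁ hn₀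
        rw [neg_smul, one_smul] at this
        convert this using 4; push_cast; ring)
    exact ⟨i, hi, by linear_combination h⟩

theorem sum_eq_sum_range_of_supp {p : ℕ} [NeZero p] {a : ZMod p → ℕ} {y : ZMod p} {L : ℕ}
    (hL : L < p) (hsupp : ∀ x, a x ≠ 0 → ∃ i : ℕ, i ≤ L ∧ x = y + i) :
    ∑ x, a x = ∑ i ∈ Finset.range (L + 1), a (y + i) := by
  symm
  refine Finset.sum_of_injOn (fun i : ℕ => y + (i : ZMod p)) ?_ (fun _ _ => by simp) ?_
    (fun _ _ => rfl)
  · intro i hi j hj hij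
    rw [Finset.mem_coe, Finset.mem_range] at hi hj
    have := congrArg ZMod.val (add_left_cancel hij)
    rwa [ZMod.val_cast_of_lt (by omega), ZMod.val_cast_of_lt (by omega)] at this
  · intro x _ hx
    by_contra h0
    obtain ⟨i, hi, rfl⟩ := hsupp x h0
    exact hx ⟨i, by rw [Finset.mem_coe, Finset.mem_range]; omega, rfl⟩

theorem LayerSizes.exists_layerHull_of_supp {p : ℕ} [Fact p.Prime] {ε : ℤ} (hε : ε = 1 ∨ ε = -1)
    {q m : ℕ} {a : ZMod p → ℕ} (ha : LayerSizes ε q m a) (hp : p = 5 * m + 3) (hm : 21 ≤ m)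
    {y : ZMod p} {L : ℕ} (hL : L ≤ m + 5)
    (hsupp : ∀ x, a x ≠ 0 → ∃ i : ℕ, i ≤ L ∧ x = y + i)
    (hn₀ : a y ≠ 0) (hn₁ : a (y + L) ≠ 0)
    (hB : m ≤ ((Finset.range (L + 1)).filter (fun i : ℕ => q < 2 * a (y + i))).card) :
    m ≤ L + 1 ∧ L ≤ m + 1 ∧ ∃ w : ℤ, w ≤ L + 1 - m ∧ 5 * ((L : ℤ) - m) - 1 - w ≤ L + 1 - m ∧
      ((ε = 1 ∧ 3 * y = ((w - 4 * L - 1 : ℤ) : ZMod p)) ∨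
        (ε = -1 ∧ y = ((w - 3 * L - 1 : ℤ) : ZMod p))) := by
  have hLm : m ≤ L + 1 := by
    refine hB.trans ((Finset.card_filter_le _ _).trans ?_)
    simp
  have hq0 : 0 < q := by have := ha.le y; omega
  obtain ⟨R, hR⟩ : ∃ R, R + L + 2 = 2 * m := ⟨2 * m - L - 2, by omega⟩
  have hsum : m * q ≤ ∑ i ∈ Finset.range (L + 1), a (y + i) := by
    rw [← sum_eq_sum_range_of_supp (by omega) hsupp]; exact ha.sum_ge
  have hρ : ∃ ρ : ZMod p, (∀ u : ℕ, u ≤ 3 → ∀ i, a i + a (i + (ρ + u * L)) ≤ q) ∧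
      ((ε = 1 ∧ 3 * y = ρ) ∨ (ε = -1 ∧ y = ρ + L)) := by
    rcases hε with rfl | rfl
    · refine ⟨3 * y, ?_, Or.inl ⟨rfl, rfl⟩⟩
      intro u hu i
      interval_cases u
      · have := ha.pair i y y y hn₀ hn₀ hn₀
        rw [one_smul] at this
        convert this using 4; push_cast; ring
      · have := ha.pair i y y (y + L) hn₀ hn₀ hn₁
        rw [one_smul] at this
        convert this using 4; push_cast; ring
      · have := ha.pair i y (y + L) (y + L) hn₀ hn₁ hn₁
        rw [one_smul] at this
        convert this using 4; push_cast; ring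
      · have := ha.pair i (y + L) (y + L) (y + L) hn₁ hn₁ hn₁
        rw [one_smul] at this
        convert this using 4; push_cast; ring
    · refine ⟨y - L, ?_, Or.inr ⟨rfl, by ring⟩⟩
      intro u hu i
      interval_cases u
      · have := ha.pair i y y (y + L) hn₀ hn₀ hn₁
        rw [neg_smul, one_smul] at this
        convert this using 4; push_cast; ring
      · have := ha.pair i y y y hn₀ hn₀ hn₀
        rw [neg_smul, one_smul] at this
        convert this using 4; push_cast; ring
      · have := ha.pair i y (y + L) y hn₀ hn₁ hn₀
        rw [neg_smul, one_smul] at this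
        convert this using 4; push_cast; ring
      · have := ha.pair i (y + L) (y + L) y hn₁ hn₁ hn₀
        rw [neg_smul, one_smul] at this
        convert this using 4; push_cast; ring
  obtain ⟨ρ, hρ, hρε⟩ := hρ
  obtain ⟨r, hr, hr1, hr2⟩ := exists_natCast_of_gaps (p := p) (R := R) (K := 3) (L := L) (ρ := ρ)
    (by omega) (fun u hu δ hδ => ne_intCast_of_pair_le hB (hρ u hu) δ (by omega))
  have hbound : ∀ v : ℕ, v ≤ 2 * L + 2 - 2 * m →
      (∀ i < v, a (y + (i : ℕ)) + a (y + ((i + (L + 1 - v) : ℕ) : ZMod p)) ≤ q) →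
      v ≤ L + 1 - m := by
    intro v hv hpair
    have := sum_range_le_of_pair (α := fun i : ℕ => a (y + (i : ZMod p))) (q := q) (N := L + 1)
      (w := v) (fun i => ha.le _) (by omega) hpair
    have h2 := Nat.le_of_mul_le_mul_right (hsum.trans this) hq0
    omega
  have hw : (4 * L + 1 + r : ℤ) - p ≤ L + 1 - m := by
    by_contra hcon
    have := hbound (4 * L + 1 + r - p) (by omega) (by
      intro i hi
      have h := hρ 3 le_rfl (y + ((i + (L + 1 - (4 * L + 1 + r - p)) : ℕ) : ZMod p))
      rw [show y + ((i + (L + 1 - (4 * L + 1 + r - p)) : ℕ) : ZMod p) + (ρ + ((3 : ℕ) : ZMod p) * L)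
        = y + i by
          rw [hr, show i + (L + 1 - (4 * L + 1 + r - p)) = i + p - 3 * L - r by omega]
          rw [Nat.cast_sub (by omega), Nat.cast_sub (by omega)]
          push_cast
          rw [ZMod.natCast_self]
          ring] at h
      omega)
    omega
  have hw' : (L + 1 : ℤ) - r ≤ L + 1 - m := by
    by_contra hcon
    have := hbound (L + 1 - r) (by omega) (by
      intro i hi
      have h := hρ 0 (Nat.zero_le _) (y + i)
      rw [show y + (i : ZMod p) + (ρ + ((0 : ℕ) : ZMod p) * L)
        = y + ((i + (L + 1 - (L + 1 - r)) : ℕ) : ZMod p) by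
          rw [hr, show i + (L + 1 - (L + 1 - r)) = i + r by omega]
          push_cast; ring] at h
      exact h)
    omega
  refine ⟨hLm, by omega, 4 * L + 1 + r - p, hw, by omega, ?_⟩
  rcases hρε with ⟨h1, h2⟩ | ⟨h1, h2⟩
  · refine Or.inl ⟨h1, ?_⟩
    rw [h2, hr]
    push_cast
    rw [ZMod.natCast_self]
    ring
  · refine Or.inr ⟨h1, ?_⟩
    rw [h2, hr]
    push_cast
    rw [ZMod.natCast_self]
    ring

theorem LayerSizes.exists_layerHull {p : ℕ} [Fact p.Prime] {ε : ℤ} (hε : ε = 1 ∨ ε = -1)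
    {q m : ℕ} {a : ZMod p → ℕ} (ha : LayerSizes ε q m a) (hp : p = 5 * m + 3) (hm : 21 ≤ m)
    (hq : Odd q) {τ : ℝ} (hτ0 : 0 < τ) (hfeas : Feasible (1 / 5 : ℝ) τ) (hm1 : 5 / τ ≤ (m : ℝ))
    (i₀ : ZMod p) (hi₀ : q < 2 * a i₀) :
    ∃ (d y : ZMod p) (L : ℕ) (w : ℤ), LayerHull ε m a d y L w := by
  obtain ⟨B, y, d, hd, hBc, hBq, hBd⟩ := ha.exists_progression hε hp hm hq hτ0 hfeas hm1 i₀ hi₀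
  have ha' := ha.dilate hd
  have hB1 : m ≤ ((Finset.range (m + 2 + 1)).filter
      (fun i : ℕ => q < 2 * a (d * (d⁻¹ * y + i)))).card := by
    rw [← hBc]
    choose! f hf1 hf2 using hBd
    refine Finset.card_le_card_of_injOn f ?_ ?_
    · intro x hx
      rw [Finset.mem_coe, Finset.mem_filter, Finset.mem_range]
      refine ⟨by have := hf1 x hx; omega, ?_⟩
      rw [mul_add, mul_inv_cancel_left₀ hd, mul_comm d (f x : ZMod p), ← hf2 x hx]
      exact hBq x hx
    · intro x hx x' hx' h
      rw [hf2 x hx, hf2 x' hx', h]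
  obtain ⟨κ, hκ⟩ := ha'.localise hε hp hm hB1
  obtain ⟨j₀, hj₀⟩ : ∃ j₀, a (d * j₀) ≠ 0 := ⟨d⁻¹ * i₀, by
    rw [mul_inv_cancel_left₀ hd]; omega⟩
  obtain ⟨i₁, L, hL, hn₀, hn₁, hall⟩ := exists_hull (fun x => a (d * x) ≠ 0) κ (m + 5) (by
    obtain ⟨i, hi, h⟩ := hκ j₀ hj₀
    exact ⟨i, hi, h ▸ hj₀⟩)
  set z := κ + i₁ with hz
  have hsupp : ∀ x, a (d * x) ≠ 0 → ∃ i : ℕ, i ≤ L ∧ x = z + i := by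
    intro x hx
    obtain ⟨i, hi, h⟩ := hκ x hx
    obtain ⟨h1, h2⟩ := hall i hi (h ▸ hx)
    refine ⟨i - i₁, by omega, ?_⟩
    rw [hz, add_assoc, ← Nat.cast_add, Nat.add_sub_cancel' h1, h]
  have hB2 : m ≤ ((Finset.range (L + 1)).filter
      (fun i : ℕ => q < 2 * a (d * (z + i)))).card := by
    rw [← hBc]
    have : ∀ x ∈ B, ∃ i : ℕ, i ≤ L ∧ d⁻¹ * x = z + i := by
      intro x hx
      refine hsupp _ ?_
      have := hBq x hx
      rw [mul_inv_cancel_left₀ hd]; omega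
    choose! f hf1 hf2 using this
    refine Finset.card_le_card_of_injOn f ?_ ?_
    · intro x hx
      rw [Finset.mem_coe, Finset.mem_filter, Finset.mem_range]
      refine ⟨by have := hf1 x hx; omega, ?_⟩
      rw [← hf2 x hx, mul_inv_cancel_left₀ hd]
      exact hBq x hx
    · intro x hx x' hx' h
      have h1 := hf2 x hx
      rw [h, ← hf2 x' hx'] at h1
      exact mul_left_cancel₀ (inv_ne_zero hd) h1
  obtain ⟨hL1, hL2, w, hw1, hw2, heq⟩ :=
    ha'.exists_layerHull_of_supp hε hp hm (by omega) hsupp hn₀ hn₁ hB2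
  have hpz := five_mul_add_three_eq_zero hp
  rcases le_total (5 * ((L : ℤ) - m) - 1) (2 * w) with h | h
  · exact ⟨d, z, L, w, hd, hsupp, hn₀, hn₁, hL1, hL2, hw1, h, heq⟩
  · refine ⟨-d, -z - L, L, 5 * ((L : ℤ) - m) - 1 - w, neg_ne_zero.2 hd, ?_, ?_, ?_, hL1, hL2,
      hw2, by omega, ?_⟩
    · intro x hx
      rw [neg_mul, ← mul_neg] at hx
      obtain ⟨i, hi, h⟩ := hsupp _ hx
      refine ⟨L - i, by omega, ?_⟩
      rw [Nat.cast_sub hi]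
      linear_combination -h
    · rwa [show -d * (-z - L) = d * (z + L) by ring]
    · rwa [show -d * (-z - L + L) = d * z by ring]
    · rcases heq with ⟨h1, h2⟩ | ⟨h1, h2⟩
      · refine Or.inl ⟨h1, ?_⟩
        push_cast at h2 ⊢
        linear_combination -h2 + hpz
      · refine Or.inr ⟨h1, ?_⟩
        push_cast at h2 ⊢
        linear_combination -h2 + hpz

theorem card_add_card_le_of_add_notMem {W : Type*} [AddCommGroup W] [Fintype W] [DecidableEq W]
    {X Y : Finset W} {g : W} (h : ∀ z ∈ X, z + g ∉ Y) : X.card + Y.card ≤ Fintype.card W := by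
  have hdisj : Disjoint (X.image (· + g)) Y := by
    rw [Finset.disjoint_left]
    intro w hw
    obtain ⟨z, hz, rfl⟩ := Finset.mem_image.1 hw
    exact h z hz
  rw [← Finset.card_image_of_injective X (add_left_injective g),
    ← Finset.card_union_of_disjoint hdisj]
  exact Finset.card_le_univ _

theorem mem_iff_add_notMem {W : Type*} [AddCommGroup W] [Fintype W] [DecidableEq W]
    {X Y : Finset W} {g : W} (h : ∀ z ∈ X, z + g ∉ Y) (hc : Fintype.card W ≤ X.card + Y.card)
    (z : W) : z ∈ X ↔ z + g ∉ Y := by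
  refine ⟨h z, fun hz => ?_⟩
  have hdisj : Disjoint (X.image (· + g)) Y := by
    rw [Finset.disjoint_left]
    intro w hw
    obtain ⟨z, hz, rfl⟩ := Finset.mem_image.1 hw
    exact h z hz
  have hu : X.image (· + g) ∪ Y = Finset.univ := by
    refine (Finset.card_eq_iff_eq_univ _).1 (le_antisymm (Finset.card_le_univ _) ?_)
    rw [Finset.card_union_of_disjoint hdisj,
      Finset.card_image_of_injective X (add_left_injective g)]
    exact hc
  have hzu : z + g ∈ X.image (· + g) ∪ Y := hu ▸ Finset.mem_univ _
  rcases Finset.mem_union.1 hzu with h1 | h1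
  · obtain ⟨z', hz', he⟩ := Finset.mem_image.1 h1
    rwa [← add_right_cancel he]
  · exact absurd h1 hz

theorem exists_submodule_of_add_sub_mem {p : ℕ} {W : Type*} [AddCommGroup W] [Module (ZMod p) W]
    {X : Finset W} {u : W} (hu : u ∈ X) (h : ∀ z ∈ X, ∀ x ∈ X, ∀ x' ∈ X, z + (x - x') ∈ X) :
    ∃ V : Submodule (ZMod p) W, ∀ z, z ∈ X ↔ z - u ∈ V := by
  let H : AddSubgroup W :=
    { carrier := {v | v + u ∈ X}
      zero_mem' := by simpa using hu
      add_mem' := by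
        intro a b ha hb
        have := h _ ha _ hb _ hu
        simp only [Set.mem_ofPred_eq]
        convert this using 1; abel
      neg_mem' := by
        intro a ha
        have := h _ hu _ hu _ ha
        simp only [Set.mem_ofPred_eq]
        convert this using 1; abel }
  refine ⟨AddSubgroup.toZModSubmodule p H, fun z => ?_⟩
  rw [AddSubgroup.mem_toZModSubmodule]
  change z ∈ X ↔ z - u + u ∈ X
  rw [sub_add_cancel]

theorem FreeEps.add_notMem_lay {α β : Type*} [AddCommGroup α] [AddCommGroup β] [DecidableEq α]
    [DecidableEq β] [Fintype β] {ε : ℤ} {D : Finset (α × β)}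
    (hD : FreeEps ε (D : Set (α × β))) {i₁ i₂ i₃ i₄ j : α} (hj : i₁ + (i₂ + i₃ + ε • i₄) = j)
    {z x₂ x₃ x₄ : β} (hz : z ∈ lay D i₁) (h₂ : x₂ ∈ lay D i₂) (h₃ : x₃ ∈ lay D i₃)
    (h₄ : x₄ ∈ lay D i₄) : z + (x₂ + x₃ + ε • x₄) ∉ lay D j := by
  intro h
  rw [mem_lay] at *
  refine hD _ hz _ h₂ _ h₃ _ h₄ _ h ?_
  rw [← hj]
  ext
  · simp only [Prod.fst_add, Prod.smul_fst]; abel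
  · simp only [Prod.snd_add, Prod.smul_snd]; abel

theorem FreeEps.layerSizes {p q m : ℕ} [NeZero p] {W : Type*} [AddCommGroup W] [Fintype W]
    [DecidableEq W] (hW : Fintype.card W = q) {ε : ℤ} {D : Finset (ZMod p × W)}
    (hD : FreeEps ε (D : Set (ZMod p × W))) (hcard : m * q ≤ D.card) :
    LayerSizes ε q m (fun i => (lay D i).card) where
  le i := hW ▸ Finset.card_le_univ _
  sum_ge := by rwa [sum_card_lay]
  pair i₁ i₂ i₃ i₄ h₂ h₃ h₄ := by
    obtain ⟨x₂, h₂⟩ := Finset.card_ne_zero.1 h₂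
    obtain ⟨x₃, h₃⟩ := Finset.card_ne_zero.1 h₃
    obtain ⟨x₄, h₄⟩ := Finset.card_ne_zero.1 h₄
    rw [← hW]
    exact card_add_card_le_of_add_notMem (fun z hz => hD.add_notMem_lay rfl hz h₂ h₃ h₄)

theorem card_eq_sum_range_lay {p L : ℕ} [NeZero p] {W : Type*} [AddCommGroup W] [Fintype W]
    [DecidableEq W] {D : Finset (ZMod p × W)} {y : ZMod p} (hL : L < p)
    (hsupp : ∀ x ∈ D, ∃ i : ℕ, i ≤ L ∧ x.1 = y + i) :
    D.card = ∑ i ∈ Finset.range (L + 1), (lay D (y + i)).card := by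
  rw [← sum_card_lay]
  refine sum_eq_sum_range_of_supp hL fun x hx => ?_
  obtain ⟨z, hz⟩ := Finset.card_ne_zero.1 hx
  exact hsupp _ (mem_lay.1 hz)

theorem eq_of_mul_le_sum_range {q M : ℕ} {β : ℕ → ℕ} (hβ : ∀ i, β i ≤ q)
    (h : M * q ≤ ∑ i ∈ Finset.range M, β i) :
    ∑ i ∈ Finset.range M, β i = M * q ∧ ∀ i < M, β i = q := by
  have h1 : ∑ i ∈ Finset.range M, q = M * q := by simp
  have h2 : ∑ i ∈ Finset.range M, β i ≤ ∑ i ∈ Finset.range M, q :=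
    Finset.sum_le_sum fun i _ => hβ i
  have h3 : ∑ i ∈ Finset.range M, β i = ∑ i ∈ Finset.range M, q := by omega
  refine ⟨h3.trans h1, fun i hi => ?_⟩
  exact (Finset.sum_eq_sum_iff_of_le fun i _ => hβ i).1 h3 i (Finset.mem_range.2 hi)

/-- The automorphism `(i, x) ↦ (i, x + i z)`. -/
def shear {R W : Type*} [Ring R] [AddCommGroup W] [Module R W] (z : W) : (R × W) ≃+ (R × W) where
  toFun x := (x.1, x.2 + x.1 • z)
  invFun x := (x.1, x.2 - x.1 • z)
  left_inv x := by simp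
  right_inv x := by simp
  map_add' x y := by
    ext
    · simp
    · simp only [Prod.snd_add, Prod.fst_add, add_smul]; abel

theorem mem_shear_image {R W : Type*} [Ring R] [AddCommGroup W] [Module R W] {z : W}
    {D : Set (R × W)} {j : R} {x : W} :
    (j, x) ∈ shear z '' D ↔ (j, x - j • z) ∈ D := by
  constructor
  · rintro ⟨⟨i, w⟩, hw, h⟩
    simp only [shear, AddEquiv.coe_mk, Equiv.coe_fn_mk, Prod.mk.injEq] at h
    obtain ⟨rfl, rfl⟩ := h
    simpa using hw
  · intro h
    exact ⟨_, h, by simp [shear]⟩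

theorem mem_of_card_lay_eq {p q : ℕ} {W : Type*} [Fintype W] [DecidableEq W]
    (hW : Fintype.card W = q) {D : Finset (ZMod p × W)} {i : ZMod p}
    (h : (lay D i).card = q) (x : W) : (i, x) ∈ D := by
  rw [← mem_lay, (Finset.card_eq_iff_eq_univ _).1 (h.trans hW.symm)]
  exact Finset.mem_univ x

theorem eq_cub_of_supp {p q m n : ℕ} [NeZero p] (hm : 1 ≤ m) (hmp : m ≤ p)
    (hW : Fintype.card (Fin n → ZMod p) = q) {D : Finset (ZMod p × (Fin n → ZMod p))}
    (hcard : m * q ≤ D.card) {y : ZMod p}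
    (hsupp : ∀ x ∈ D, ∃ i : ℕ, i ≤ m - 1 ∧ x.1 = y + i) :
    D.card = m * q ∧ (D : Set (ZMod p × (Fin n → ZMod p))) = cub p n y (m - 1) := by
  have h1 := card_eq_sum_range_lay (by omega) hsupp
  rw [Nat.sub_add_cancel hm] at h1
  rw [h1] at hcard
  obtain ⟨h2, h3⟩ := eq_of_mul_le_sum_range
    (fun i => (Finset.card_le_univ _).trans hW.le) hcard
  refine ⟨h1.trans h2, ?_⟩
  ext ⟨j, x⟩
  constructor
  · intro hx
    exact hsupp _ hx
  · rintro ⟨i, hi, hj⟩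
    simp only at hj
    rw [hj]
    exact mem_of_card_lay_eq hW (h3 i (by omega)) x

theorem card_lay_of_pair {p q m n : ℕ} [NeZero p] (hm : 2 ≤ m) (hmp : m < p)
    (hW : Fintype.card (Fin n → ZMod p) = q) {D : Finset (ZMod p × (Fin n → ZMod p))}
    (hcard : m * q ≤ D.card) {y : ZMod p}
    (hsupp : ∀ x ∈ D, ∃ i : ℕ, i ≤ m ∧ x.1 = y + i)
    (hpair : (lay D (y + m)).card + (lay D y).card ≤ q) :
    D.card = m * q ∧ q ≤ (lay D (y + m)).card + (lay D y).card ∧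
      ∀ i : ℕ, 1 ≤ i → i < m → ∀ x, (y + i, x) ∈ D := by
  have h1 := card_eq_sum_range_lay hmp hsupp
  obtain ⟨M, rfl⟩ : ∃ M, m = M + 1 := ⟨m - 1, by omega⟩
  rw [Finset.sum_range_succ, Finset.sum_range_succ', Nat.cast_zero, add_zero] at h1
  have h0 : (M + 1) * q = M * q + q := by ring
  obtain ⟨h2, h3⟩ := eq_of_mul_le_sum_range (q := q) (M := M)
    (β := fun i : ℕ => (lay D (y + ((i + 1 : ℕ) : ZMod p))).card)
    (fun i => (Finset.card_le_univ _).trans hW.le) (by omega)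
  refine ⟨by omega, by omega, fun i hi hi' x => mem_of_card_lay_eq hW ?_ x⟩
  have := h3 (i - 1) (by omega)
  rwa [Nat.sub_add_cancel hi] at this

theorem card_lay_of_two_pairs {p q m n : ℕ} [NeZero p] (hm : 3 ≤ m) (hmp : m + 1 < p)
    (hW : Fintype.card (Fin n → ZMod p) = q) {D : Finset (ZMod p × (Fin n → ZMod p))}
    (hcard : m * q ≤ D.card) {y : ZMod p}
    (hsupp : ∀ x ∈ D, ∃ i : ℕ, i ≤ m + 1 ∧ x.1 = y + i)
    (hpair₀ : (lay D (y + m)).card + (lay D y).card ≤ q)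
    (hpair₁ : (lay D (y + (m + 1 : ℕ))).card + (lay D (y + 1)).card ≤ q) :
    D.card = m * q ∧ q ≤ (lay D (y + m)).card + (lay D y).card ∧
      q ≤ (lay D (y + (m + 1 : ℕ))).card + (lay D (y + 1)).card ∧
      ∀ i : ℕ, 2 ≤ i → i < m → ∀ x, (y + i, x) ∈ D := by
  have h1 := card_eq_sum_range_lay hmp hsupp
  obtain ⟨M, rfl⟩ : ∃ M, m = M + 2 := ⟨m - 2, by omega⟩
  rw [Finset.sum_range_succ, Finset.sum_range_succ, Finset.sum_range_succ',
    Finset.sum_range_succ', Nat.cast_zero, add_zero, zero_add, Nat.cast_one,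
    show M + 3 = M + 2 + 1 from rfl] at h1
  have h0 : (M + 2) * q = M * q + q + q := by ring
  obtain ⟨h2, h3⟩ := eq_of_mul_le_sum_range (q := q) (M := M)
    (β := fun i : ℕ => (lay D (y + ((i + 1 + 1 : ℕ) : ZMod p))).card)
    (fun i => (Finset.card_le_univ _).trans hW.le) (by omega)
  refine ⟨by omega, by omega, by omega, fun i hi hi' x => mem_of_card_lay_eq hW ?_ x⟩
  have := h3 (i - 2) (by omega)
  rwa [show i - 2 + 1 + 1 = i by omega] at this

/-- Structure of a `FreeEps 1` set supported on `m + 1` consecutive layers with `4m = -3y`. -/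
theorem exists_submodule_of_supp_succ {p q m n : ℕ} [Fact p.Prime] (hp : p = 5 * m + 3)
    (hm : 21 ≤ m) (hW : Fintype.card (Fin n → ZMod p) = q)
    {D : Finset (ZMod p × (Fin n → ZMod p))}
    (hD : FreeEps 1 (D : Set (ZMod p × (Fin n → ZMod p)))) (hcard : m * q ≤ D.card) {y : ZMod p}
    (hsupp : ∀ x ∈ D, ∃ i : ℕ, i ≤ m ∧ x.1 = y + i)
    (h₀ : (lay D y).Nonempty) (h₁ : (lay D (y + m)).Nonempty) (hy : 3 * y = -(4 * m)) :
    D.card = m * q ∧ ∃ (V : Submodule (ZMod p) (Fin n → ZMod p)) (z : Fin n → ZMod p), V ≠ ⊤ ∧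
      shear z '' (D : Set (ZMod p × (Fin n → ZMod p))) =
      ({y} ×ˢ (Set.univ \ (V : Set (Fin n → ZMod p)))) ∪
        ((Ival (y + 1) (m - 2)) ×ˢ (Set.univ : Set (Fin n → ZMod p))) ∪
        ({y + (m : ZMod p)} ×ˢ (V : Set (Fin n → ZMod p))) := by
  obtain ⟨u, hu⟩ := h₁
  have hidx : y + m + (y + m + (y + m) + (1 : ℤ) • (y + m)) = y := by
    rw [one_smul]; linear_combination hy
  have hrel : ∀ z ∈ lay D (y + m), ∀ a ∈ lay D (y + m), ∀ b ∈ lay D (y + m),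
      ∀ c ∈ lay D (y + m), z + (a + b + (1 : ℤ) • c) ∉ lay D y :=
    fun z hz a ha b hb c hc => hD.add_notMem_lay hidx hz ha hb hc
  have hpair := hW ▸ card_add_card_le_of_add_notMem (fun z hz => hrel z hz u hu u hu u hu)
  obtain ⟨hDc, htight, hfull⟩ := card_lay_of_pair (by omega) (by omega) hW hcard hsupp hpair
  refine ⟨hDc, ?_⟩
  have hiff : ∀ a ∈ lay D (y + m), ∀ b ∈ lay D (y + m), ∀ c ∈ lay D (y + m), ∀ z,
      z ∈ lay D (y + m) ↔ z + (a + b + (1 : ℤ) • c) ∉ lay D y :=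
    fun a ha b hb c hc => mem_iff_add_notMem (fun z hz => hrel z hz a ha b hb c hc)
      (hW.le.trans htight)
  obtain ⟨V, hV⟩ := exists_submodule_of_add_sub_mem (p := p) hu (by
    intro z hz x hx x' hx'
    rw [hiff x' hx' u hu u hu, show z + (x - x') + (x' + u + (1 : ℤ) • u)
      = z + (x + u + (1 : ℤ) • u) by abel]
    exact hrel z hz x hx u hu u hu)
  have hY : ∀ z, z ∈ lay D y ↔ z - (4 : ZMod p) • u ∉ V := by
    intro z
    have h1 := hiff u hu u hu u hu (z - (3 : ZMod p) • u)
    have e3 : (3 : ZMod p) • u = u + u + (1 : ℤ) • u := by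
      rw [one_smul, show (3 : ZMod p) = 1 + 1 + 1 by norm_num, add_smul, add_smul, one_smul]
    have e4 : (4 : ZMod p) • u = (3 : ZMod p) • u + u := by
      rw [show (4 : ZMod p) = 3 + 1 by norm_num, add_smul, one_smul]
    rw [← e3, sub_add_cancel, hV, sub_sub, ← e4] at h1
    tauto
  have hm0 : y + m ≠ 0 := by
    intro h
    have h3 : (m : ZMod p) = 0 := by linear_combination hy - 3 * h
    rw [ZMod.natCast_eq_zero_iff] at h3
    have := Nat.le_of_dvd (by omega) h3
    omega
  refine ⟨V, -((y + m)⁻¹ • u), ?_, ?_⟩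
  · rintro rfl
    obtain ⟨z, hz⟩ := h₀
    exact (hY z).1 hz trivial
  · have hX' : ∀ x, (y + (m : ZMod p), x) ∈
        shear (-((y + m)⁻¹ • u)) '' (D : Set (ZMod p × (Fin n → ZMod p))) ↔ x ∈ V := by
      intro x
      rw [mem_shear_image, Finset.mem_coe, ← mem_lay, hV, smul_neg, smul_smul,
        mul_inv_cancel₀ hm0, one_smul, sub_neg_eq_add, add_sub_cancel_right]
    have hY' : ∀ x, (y, x) ∈
        shear (-((y + m)⁻¹ • u)) '' (D : Set (ZMod p × (Fin n → ZMod p))) ↔ x ∉ V := by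
      intro x
      have : y * (y + m)⁻¹ = 4 := by
        rw [← div_eq_mul_inv, div_eq_iff hm0]; linear_combination -hy
      rw [mem_shear_image, Finset.mem_coe, ← mem_lay, hY, smul_neg, smul_smul, this,
        sub_neg_eq_add, add_sub_cancel_right]
    ext ⟨j, x⟩
    constructor
    · intro hx
      obtain ⟨i, hi, hj⟩ := hsupp _ (mem_shear_image.1 hx)
      simp only at hj
      subst hj
      rcases Nat.eq_zero_or_pos i with rfl | hi0
      · rw [Nat.cast_zero, add_zero] at hx ⊢
        exact Or.inl (Or.inl ⟨rfl, trivial, (hY' x).1 hx⟩)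
      rcases hi.eq_or_lt with rfl | him
      · exact Or.inr ⟨rfl, (hX' x).1 hx⟩
      · refine Or.inl (Or.inr ⟨⟨i - 1, by omega, ?_⟩, trivial⟩)
        rw [Nat.cast_sub hi0]; push_cast; ring
    · rintro ((⟨rfl, -, hx⟩ | ⟨⟨i, hi, hj⟩, -⟩) | ⟨rfl, hx⟩)
      · exact (hY' x).2 hx
      · simp only at hj
        rw [mem_shear_image, Finset.mem_coe, hj, show y + 1 + (i : ZMod p)
          = y + ((i + 1 : ℕ) : ZMod p) by push_cast; ring]
        exact hfull _ (by omega) (by omega) _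
      · exact (hX' x).2 hx

theorem card_le_of_sub_mem {p : ℕ} {W : Type*} [AddCommGroup W] [Module (ZMod p) W] [Finite W]
    {V : Submodule (ZMod p) W} {u : W} {X : Finset W} (h : ∀ x ∈ X, x - u ∈ V) :
    X.card ≤ Nat.card V.toAddSubgroup := by
  classical
  rw [← Finset.card_image_of_injective X (sub_left_injective (b := u)), ← Set.ncard_coe_finset]
  change _ ≤ Nat.card (V.toAddSubgroup : Set W)
  rw [Nat.card_coe_set_eq]
  refine Set.ncard_le_ncard ?_ (Set.toFinite _)
  intro w hw
  rw [Finset.mem_coe] at hw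
  obtain ⟨x, hx, rfl⟩ := Finset.mem_image.1 hw
  exact h x hx

theorem false_of_supp_succ {p q m n : ℕ} [Fact p.Prime] (hp : p = 5 * m + 3)
    (hm : 21 ≤ m) (hW : Fintype.card (Fin n → ZMod p) = q)
    {D : Finset (ZMod p × (Fin n → ZMod p))}
    (hD : FreeEps (-1) (D : Set (ZMod p × (Fin n → ZMod p)))) (hcard : m * q ≤ D.card)
    {y : ZMod p} (hsupp : ∀ x ∈ D, ∃ i : ℕ, i ≤ m ∧ x.1 = y + i)
    (h₀ : (lay D y).Nonempty) (h₁ : (lay D (y + m)).Nonempty) (hy : y = -(3 * m)) : False := by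
  have hpp := (Fact.out : p.Prime)
  obtain ⟨u, hu⟩ := h₁
  obtain ⟨v, hv⟩ := h₀
  have hidx : y + m + (y + m + (y + m) + (-1 : ℤ) • y) = y := by
    rw [neg_smul, one_smul]; linear_combination hy
  have hrel : ∀ z ∈ lay D (y + m), ∀ a ∈ lay D (y + m), ∀ b ∈ lay D (y + m),
      ∀ c ∈ lay D y, z + (a + b + (-1 : ℤ) • c) ∉ lay D y :=
    fun z hz a ha b hb c hc => hD.add_notMem_lay hidx hz ha hb hc
  have hpair := hW ▸ card_add_card_le_of_add_notMem (fun z hz => hrel z hz u hu u hu v hv)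
  obtain ⟨hDc, htight, hfull⟩ := card_lay_of_pair (by omega) (by omega) hW hcard hsupp hpair
  have hiff : ∀ a ∈ lay D (y + m), ∀ b ∈ lay D (y + m), ∀ c ∈ lay D y, ∀ z,
      z ∈ lay D (y + m) ↔ z + (a + b + (-1 : ℤ) • c) ∉ lay D y :=
    fun a ha b hb c hc => mem_iff_add_notMem (fun z hz => hrel z hz a ha b hb c hc)
      (hW.le.trans htight)
  obtain ⟨V, hV⟩ := exists_submodule_of_add_sub_mem (p := p) hu (by
    intro z hz x hx x' hx'
    rw [hiff x' hx' u hu v hv, show z + (x - x') + (x' + u + (-1 : ℤ) • v)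
      = z + (x + u + (-1 : ℤ) • v) by abel]
    exact hrel z hz x hx u hu v hv)
  have hYV : ∀ x ∈ lay D y, x - v ∈ V := by
    intro x hx
    have h1 : u + (x - v) ∈ lay D (y + m) := by
      rw [hiff u hu u hu x hx, show u + (x - v) + (u + u + (-1 : ℤ) • x)
        = u + (u + u + (-1 : ℤ) • v) by rw [neg_smul, neg_smul, one_smul, one_smul]; abel]
      exact hrel u hu u hu u hu v hv
    rw [hV] at h1
    simpa using h1
  have hVtop : V.toAddSubgroup ≠ ⊤ := by
    intro h
    have hall : ∀ z, z ∈ lay D (y + m) := fun z => by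
      rw [hV, ← Submodule.mem_toAddSubgroup, h]; trivial
    refine (hiff u hu u hu v hv (v - (u + u + (-1 : ℤ) • v))).1 (hall _) ?_
    rwa [sub_add_cancel]
  have hVc := AddSubgroup.prime_mul_card_le (k := n) hpp (by simp [ZMod.card]) _ hVtop
  have h1 := card_le_of_sub_mem (fun x hx => (hV x).1 hx)
  have h2 := card_le_of_sub_mem hYV
  rw [hW] at hVc
  have h3 : 0 < (lay D y).card := Finset.card_pos.2 ⟨v, hv⟩
  nlinarith

theorem exists_submodule_of_add_notMem {p : ℕ} [Fact p.Prime] (h3 : (3 : ZMod p) ≠ 0) {W : Type*}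
    [AddCommGroup W] [Module (ZMod p) W] [Fintype W] [DecidableEq W] {X Y X' Y' : Finset W}
    {u v c c' : W} (hu : u ∈ X) (hv : v ∈ X') (hc : (c = u ∧ c' = v) ∨ (c = -v ∧ c' = -u))
    (hXY : ∀ a ∈ X, ∀ b ∈ X, ∀ z ∈ X, z + (a + b + c) ∉ Y)
    (hYX : ∀ a ∈ X', ∀ b ∈ X', ∀ z ∈ Y, z + (a + b + c') ∉ X)
    (hXY' : ∀ a ∈ X', ∀ b ∈ X', ∀ z ∈ X', z + (a + b + c') ∉ Y')
    (hYX' : ∀ a ∈ X, ∀ b ∈ X, ∀ z ∈ Y', z + (a + b + c) ∉ X')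
    (ht : Fintype.card W ≤ X.card + Y.card) (ht' : Fintype.card W ≤ X'.card + Y'.card) :
    ∃ V : Submodule (ZMod p) W, (∀ z, z ∈ X ↔ z - u ∈ V) ∧ (∀ z, z ∈ X' ↔ z + u ∈ V) ∧
      (∀ z, z ∈ Y ↔ z - (4 : ZMod p) • u ∉ V) ∧ (∀ z, z ∈ Y' ↔ z + (4 : ZMod p) • u ∉ V) := by
  have i1 := fun a ha b hb => mem_iff_add_notMem (hXY a ha b hb) ht
  have i2 := fun a ha b hb => mem_iff_add_notMem (hYX a ha b hb) (by omega)
  have i3 := fun a ha b hb => mem_iff_add_notMem (hXY' a ha b hb) ht'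
  have i4 := fun a ha b hb => mem_iff_add_notMem (hYX' a ha b hb) (by omega)
  have j1 : ∀ a ∈ X, ∀ b ∈ X, ∀ a' ∈ X', ∀ b' ∈ X', ∀ z,
      z ∈ X ↔ z + (a + b + c) + (a' + b' + c') ∈ X := fun a ha b hb a' ha' b' hb' z => by
    rw [i1 a ha b hb, i2 a' ha' b' hb', not_not]
  have j2 : ∀ a ∈ X, ∀ b ∈ X, ∀ a' ∈ X', ∀ b' ∈ X', ∀ z,
      z ∈ X' ↔ z + (a + b + c) + (a' + b' + c') ∈ X' := fun a ha b hb a' ha' b' hb' z => by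
    rw [add_right_comm, i3 a' ha' b' hb', i4 a ha b hb, not_not]
  obtain ⟨V, hV⟩ := exists_submodule_of_add_sub_mem (p := p) hu (by
    intro z hz x hx x' hx'
    rw [i1 x' hx' u hu, show z + (x - x') + (x' + u + c) = z + (x + u + c) by abel]
    exact hXY x hx u hu z hz)
  obtain ⟨V', hV'⟩ := exists_submodule_of_add_sub_mem (p := p) hv (by
    intro z hz x hx x' hx'
    rw [i3 x' hx' v hv, show z + (x - x') + (x' + v + c') = z + (x + v + c') by abel]
    exact hXY' x hx v hv z hz)
  have hVV' : ∀ w, w ∈ V ↔ w ∈ V' := by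
    intro w
    constructor
    · intro hw
      have hw' : w + u ∈ X := by rw [hV]; simpa using hw
      have h1 := (j2 u hu u hu v hv v hv (v + w - (w + u + u + c + (v + v + c')) + (u + u + c +
        (v + v + c'))))
      have h2 := (j2 _ hw' u hu v hv v hv (v - (u + u + c) - (v + v + c')))
      have h3 := (j2 u hu u hu v hv v hv (v - (u + u + c) - (v + v + c')))
      rw [show v - (u + u + c) - (v + v + c') + (u + u + c) + (v + v + c') = v by abel] at h3
      rw [show v - (u + u + c) - (v + v + c') + (w + u + u + c) + (v + v + c') = v + w by abel]
        at h2
      have h4 := (hV' _).1 (h2.1 (h3.2 hv))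
      simpa using h4
    · intro hw
      have hw' : w + v ∈ X' := by rw [hV']; simpa using hw
      have h2 := (j1 u hu u hu _ hw' v hv (u - (u + u + c) - (v + v + c')))
      have h3 := (j1 u hu u hu v hv v hv (u - (u + u + c) - (v + v + c')))
      rw [show u - (u + u + c) - (v + v + c') + (u + u + c) + (v + v + c') = u by abel] at h3
      rw [show u - (u + u + c) - (v + v + c') + (u + u + c) + (w + v + v + c') = u + w by abel]
        at h2
      have h4 := (hV _).1 (h2.1 (h3.2 hu))
      simpa using h4
  have e4 : (4 : ZMod p) • u = u + u + u + u := by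
    rw [show (4 : ZMod p) = 1 + 1 + 1 + 1 by norm_num]; simp only [add_smul, one_smul]
  have huv : u + v ∈ V := by
    have h := (hV _).1 ((j1 u hu u hu v hv v hv u).1 hu)
    rcases hc with ⟨rfl, rfl⟩ | ⟨rfl, rfl⟩
    · rw [show c + (c + c + c) + (c' + c' + c') - c = (3 : ZMod p) • (c + c') by
        rw [show (3 : ZMod p) = 1 + 1 + 1 by norm_num]; simp only [add_smul, one_smul]; abel] at h
      exact (V.smul_mem_iff h3).1 h
    · rwa [show u + (u + u + -v) + (v + v + -u) - u = u + v by abel] at h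
  have hcu : c - u ∈ V := by
    rcases hc with ⟨rfl, rfl⟩ | ⟨rfl, rfl⟩
    · simp
    · rw [show -v - u = -(u + v) by abel]; exact V.neg_mem huv
  have hcv : c' + u ∈ V := by
    rcases hc with ⟨rfl, rfl⟩ | ⟨rfl, rfl⟩
    · rwa [add_comm]
    · simp
  have hX' : ∀ z, z ∈ X' ↔ z + u ∈ V := by
    intro z
    rw [hV', ← hVV', show z + u = z - v + (u + v) by abel, V.add_mem_iff_left huv]
  refine ⟨V, hV, hX', fun z => ?_, fun z => ?_⟩
  · have h := i1 u hu u hu (z - (u + u + c))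
    rw [sub_add_cancel, hV, show z - (u + u + c) - u = z - (4 : ZMod p) • u - (c - u) by
      rw [e4]; abel, V.sub_mem_iff_left hcu] at h
    tauto
  · have h := i3 v hv v hv (z - (v + v + c'))
    rw [sub_add_cancel, hX', show z - (v + v + c') + u = z + (4 : ZMod p) • u
      - ((c' + u) + (u + v) + (u + v)) by rw [e4]; abel,
      V.sub_mem_iff_left (V.add_mem (V.add_mem hcv huv) huv)] at h
    tauto

/-- Structure of a `FreeEps ε` set supported on `m + 2` consecutive layers starting at
`y = 2m + 1`. -/
theorem exists_submodule_of_supp_succ_succ {p q m n : ℕ} [Fact p.Prime] (hp : p = 5 * m + 3)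
    (hm : 21 ≤ m) (hW : Fintype.card (Fin n → ZMod p) = q) {ε : ℤ} (hε : ε = 1 ∨ ε = -1)
    {D : Finset (ZMod p × (Fin n → ZMod p))}
    (hD : FreeEps ε (D : Set (ZMod p × (Fin n → ZMod p)))) (hcard : m * q ≤ D.card) {y : ZMod p}
    (hsupp : ∀ x ∈ D, ∃ i : ℕ, i ≤ m + 1 ∧ x.1 = y + i)
    (h₀ : (lay D y).Nonempty) (h₁ : (lay D (y + (m + 1 : ℕ))).Nonempty) (hy : y = 2 * m + 1) :
    D.card = m * q ∧ ∃ (V : Submodule (ZMod p) (Fin n → ZMod p)) (z : Fin n → ZMod p),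
      shear z '' (D : Set (ZMod p × (Fin n → ZMod p))) =
      (({y, y + (m + 1 : ℕ)} : Set (ZMod p)) ×ˢ (V : Set (Fin n → ZMod p))) ∪
        (({y + 1, y + m} : Set (ZMod p)) ×ˢ (Set.univ \ (V : Set (Fin n → ZMod p)))) ∪
        ((Ival (y + 2) (m - 3)) ×ˢ (Set.univ : Set (Fin n → ZMod p))) := by
  have hpp := (Fact.out : p.Prime)
  have hp0 := five_mul_add_three_eq_zero hp
  have hy5 : 5 * y + 1 = 0 := by linear_combination 5 * hy + 2 * hp0
  have hmy : (m : ZMod p) = 3 * y := by linear_combination (-3 : ZMod p) * hy - hp0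
  have h3 : (3 : ZMod p) ≠ 0 := by
    intro h
    have h' : ((3 : ℕ) : ZMod p) = 0 := by exact_mod_cast h
    rw [ZMod.natCast_eq_zero_iff] at h'
    have := Nat.le_of_dvd (by omega) h'
    omega
  have hy0 : y ≠ 0 := by
    rintro rfl
    simp at hy5
  have k1 : y + 1 = -(4 * y) := by linear_combination hy5
  have k2 : y + m = 4 * y := by linear_combination hmy
  have k3 : y + (m + 1 : ℕ) = -y := by push_cast; linear_combination hmy + hy5
  rw [k3] at h₁
  obtain ⟨u, hu⟩ := h₁
  obtain ⟨v, hv⟩ := h₀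
  obtain ⟨i, j, w, w', hij, hw, hw', hc⟩ : ∃ (i j : ZMod p) (w w' : Fin n → ZMod p),
      (ε • i = -y ∧ ε • j = y) ∧ w ∈ lay D i ∧ w' ∈ lay D j ∧
      ((ε • w = u ∧ ε • w' = v) ∨ (ε • w = -v ∧ ε • w' = -u)) := by
    rcases hε with rfl | rfl
    · exact ⟨-y, y, u, v, by simp, hu, hv, by simp⟩
    · exact ⟨y, -y, v, u, by simp, hv, hu, by simp⟩
  have r1 : ∀ a ∈ lay D (-y), ∀ b ∈ lay D (-y), ∀ z ∈ lay D (-y),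
      z + (a + b + ε • w) ∉ lay D (-(4 * y)) := fun a ha b hb z hz =>
    hD.add_notMem_lay (by rw [hij.1]; ring) hz ha hb hw
  have r2 : ∀ a ∈ lay D y, ∀ b ∈ lay D y, ∀ z ∈ lay D (-(4 * y)),
      z + (a + b + ε • w') ∉ lay D (-y) := fun a ha b hb z hz =>
    hD.add_notMem_lay (by rw [hij.2]; ring) hz ha hb hw'
  have r3 : ∀ a ∈ lay D y, ∀ b ∈ lay D y, ∀ z ∈ lay D y,
      z + (a + b + ε • w') ∉ lay D (4 * y) := fun a ha b hb z hz =>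
    hD.add_notMem_lay (by rw [hij.2]; ring) hz ha hb hw'
  have r4 : ∀ a ∈ lay D (-y), ∀ b ∈ lay D (-y), ∀ z ∈ lay D (4 * y),
      z + (a + b + ε • w) ∉ lay D y := fun a ha b hb z hz =>
    hD.add_notMem_lay (by rw [hij.1]; ring) hz ha hb hw
  obtain ⟨hDc, t0, t1, hfull⟩ := card_lay_of_two_pairs (by omega) (by omega) hW hcard hsupp
    (by rw [k2]; exact hW ▸ card_add_card_le_of_add_notMem (r4 u hu u hu))
    (by rw [k1, k3]; exact hW ▸ card_add_card_le_of_add_notMem (r1 u hu u hu))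
  rw [k2] at t0
  rw [k1, k3] at t1
  obtain ⟨V, hX, hX', hY, hY'⟩ := exists_submodule_of_add_notMem h3 hu hv hc r1 r2 r3 r4
    (by omega) (by omega)
  refine ⟨hDc, V, y⁻¹ • u, ?_⟩
  have e0 : ∀ x, (y, x) ∈ shear (y⁻¹ • u) '' (D : Set (ZMod p × (Fin n → ZMod p))) ↔ x ∈ V := by
    intro x
    rw [mem_shear_image, Finset.mem_coe, ← mem_lay, hX', smul_smul, mul_inv_cancel₀ hy0, one_smul,
      sub_add_cancel]
  have eL : ∀ x, (y + (m + 1 : ℕ), x) ∈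
      shear (y⁻¹ • u) '' (D : Set (ZMod p × (Fin n → ZMod p))) ↔ x ∈ V := by
    intro x
    rw [k3, mem_shear_image, Finset.mem_coe, ← mem_lay, hX, smul_smul, neg_mul,
      mul_inv_cancel₀ hy0, neg_smul, one_smul, sub_neg_eq_add, add_sub_cancel_right]
  have e1 : ∀ x, (y + 1, x) ∈
      shear (y⁻¹ • u) '' (D : Set (ZMod p × (Fin n → ZMod p))) ↔ x ∉ V := by
    intro x
    rw [k1, mem_shear_image, Finset.mem_coe, ← mem_lay, hY, smul_smul, neg_mul,
      mul_assoc, mul_inv_cancel₀ hy0, mul_one, neg_smul, sub_neg_eq_add, add_sub_cancel_right]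
  have em : ∀ x, (y + m, x) ∈
      shear (y⁻¹ • u) '' (D : Set (ZMod p × (Fin n → ZMod p))) ↔ x ∉ V := by
    intro x
    rw [k2, mem_shear_image, Finset.mem_coe, ← mem_lay, hY', smul_smul,
      mul_assoc, mul_inv_cancel₀ hy0, mul_one, sub_add_cancel]
  ext ⟨j, x⟩
  constructor
  · intro hx
    obtain ⟨i, hi, hj⟩ := hsupp _ (mem_shear_image.1 hx)
    simp only at hj
    subst hj
    rcases Nat.eq_zero_or_pos i with rfl | hi0
    · rw [Nat.cast_zero, add_zero] at hx ⊢
      exact Or.inl (Or.inl ⟨Or.inl rfl, (e0 x).1 hx⟩)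
    rcases (show i = 1 ∨ 1 < i by omega) with rfl | hi1
    · rw [Nat.cast_one] at hx ⊢
      exact Or.inl (Or.inr ⟨Or.inl rfl, trivial, (e1 x).1 hx⟩)
    rcases hi.eq_or_lt with rfl | him
    · exact Or.inl (Or.inl ⟨Or.inr rfl, (eL x).1 hx⟩)
    rcases (Nat.lt_succ_iff.1 him).eq_or_lt with rfl | him'
    · exact Or.inl (Or.inr ⟨Or.inr rfl, trivial, (em x).1 hx⟩)
    · refine Or.inr ⟨⟨i - 2, by omega, ?_⟩, trivial⟩
      rw [Nat.cast_sub (by omega)]; push_cast; ring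
  · rintro ((⟨hj | hj, hx⟩ | ⟨hj | hj, -, hx⟩) | ⟨⟨i, hi, hj⟩, -⟩)
    · simp only at hj; subst hj; exact (e0 x).2 hx
    · simp only [Set.mem_singleton_iff] at hj; subst hj; exact (eL x).2 hx
    · simp only at hj; subst hj; exact (e1 x).2 hx
    · simp only [Set.mem_singleton_iff] at hj; subst hj; exact (em x).2 hx
    · simp only at hj
      rw [mem_shear_image, Finset.mem_coe, hj, show y + 2 + (i : ZMod p)
        = y + ((i + 2 : ℕ) : ZMod p) by push_cast; ring]
      exact hfull _ (by omega) (by omega) _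

/-- The automorphism `(i, x) ↦ (c i, x)`. -/
def scaleFst {F W : Type*} [Field F] [AddCommGroup W] (c : F) (hc : c ≠ 0) :
    (F × W) ≃+ (F × W) where
  toFun x := (c * x.1, x.2)
  invFun x := (c⁻¹ * x.1, x.2)
  left_inv x := by simp [hc]
  right_inv x := by simp [hc]
  map_add' x y := by simp [mul_add]

theorem FreeEps.image {G H : Type*} [AddCommGroup G] [AddCommGroup H] {ε : ℤ} {A : Set G}
    (h : FreeEps ε A) (f : G ≃+ H) : FreeEps ε (f '' A) := by
  rintro _ ⟨a, ha, rfl⟩ _ ⟨b, hb, rfl⟩ _ ⟨c, hc, rfl⟩ _ ⟨d, hd, rfl⟩ _ ⟨e, he, rfl⟩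
  rw [← map_add, ← map_add, ← map_zsmul, ← map_add]
  exact fun heq => h a ha b hb c hc d hd e he (f.injective heq)

theorem KLFree.freeEps_one {G : Type*} [AddCommGroup G] {A : Set G} (h : KLFree 4 1 A) :
    FreeEps 1 A := by
  intro a ha b hb c hc d hd e he heq
  have h1 : e ∈ itSum 4 A ∩ itSum 1 A := by
    simp only [itSum, Set.singleton_add, zero_add, Set.image_id']
    refine ⟨?_, he⟩
    rw [← heq, one_smul]
    exact Set.add_mem_add (Set.add_mem_add (Set.add_mem_add ha hb) hc) hd
  rw [h] at h1
  exact h1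

theorem KLFree.freeEps_neg_one {G : Type*} [AddCommGroup G] {A : Set G} (h : KLFree 3 2 A) :
    FreeEps (-1) A := by
  intro a ha b hb c hc d hd e he heq
  have h1 : e + d ∈ itSum 3 A ∩ itSum 2 A := by
    simp only [itSum, Set.singleton_add, zero_add, Set.image_id']
    refine ⟨?_, Set.add_mem_add he hd⟩
    rw [← heq, neg_smul, one_smul, neg_add_cancel_right]
    exact Set.add_mem_add (Set.add_mem_add ha hb) hc
  rw [h] at h1
  exact h1

/-- After an isomorphism, a large `FreeEps ε` set is supported on few consecutive layers. -/
theorem FreeEps.exists_addEquiv_supp {p n m : ℕ} [Fact p.Prime] (hp : p = 5 * m + 3) (hm : 21 ≤ m)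
    (hn : 1 ≤ n) {τ : ℝ} (hτ0 : 0 < τ) (hfeas : Feasible (1 / 5 : ℝ) τ) (hm1 : 5 / τ ≤ (m : ℝ))
    {ε : ℤ} (hε : ε = 1 ∨ ε = -1) {A : Set (Fin n → ZMod p)} (hA : A.Nonempty)
    (hfree : FreeEps ε A) (hcard : m * p ^ (n - 1) ≤ A.ncard) :
    ∃ (e : (Fin n → ZMod p) ≃+ (ZMod p × (Fin (n - 1) → ZMod p)))
      (D : Finset (ZMod p × (Fin (n - 1) → ZMod p))) (y : ZMod p) (L : ℕ) (w : ℤ),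
      e '' A = D ∧ D.card = A.ncard ∧ (∀ x ∈ D, ∃ i : ℕ, i ≤ L ∧ x.1 = y + i) ∧
      (lay D y).Nonempty ∧ (lay D (y + L)).Nonempty ∧ m ≤ L + 1 ∧ L ≤ m + 1 ∧
      w ≤ L + 1 - m ∧ 5 * ((L : ℤ) - m) - 1 ≤ 2 * w ∧
      ((ε = 1 ∧ 3 * y = ((w - 4 * L - 1 : ℤ) : ZMod p)) ∨
        (ε = -1 ∧ y = ((w - 3 * L - 1 : ℤ) : ZMod p))) := by
  classical
  have hpp := (Fact.out : p.Prime)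
  obtain ⟨A, rfl⟩ : ∃ B : Finset (Fin n → ZMod p), A = B :=
    ⟨(Set.toFinite A).toFinset, (Set.toFinite A).coe_toFinset.symm⟩
  rw [Set.ncard_coe_finset] at hcard ⊢
  have hG : Fintype.card (Fin n → ZMod p) = p ^ n := by simp [ZMod.card]
  have hW : Fintype.card (Fin (n - 1) → ZMod p) = p ^ (n - 1) := by simp [ZMod.card]
  have hS : (A + A).card ≤ (2 * m + 2) * p ^ (n - 1) :=
    FreeEps.card_add_self_le hε hp (AddSubgroup.prime_mul_card_le hpp hG)
      (by rw [hG, ← pow_succ', Nat.sub_add_cancel hn]) (Finset.coe_nonempty.1 hA) hfree hcard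
  obtain ⟨e, i₀, hi₀⟩ := exists_addEquiv_big_layer hp hm hn A hcard hS
  have himage : ∀ f : (Fin n → ZMod p) ≃+ (ZMod p × (Fin (n - 1) → ZMod p)),
      f '' (A : Set (Fin n → ZMod p)) = (A.map f.toEquiv.toEmbedding : Finset _) := fun f => by
    ext x; simp
  have hfree' := himage e ▸ hfree.image e
  have hodd : Odd (p ^ (n - 1)) := (hpp.odd_of_ne_two (by omega)).pow
  obtain ⟨d, y, L, w, h⟩ := (hfree'.layerSizes hW (by rwa [Finset.card_map])).exists_layerHull hε hp
    hm hodd hτ0 hfeas hm1 i₀ hi₀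
  have hd := inv_ne_zero h.d_ne
  have hlay : ∀ x, lay (A.map (e.trans (scaleFst d⁻¹ hd)).toEquiv.toEmbedding) x
      = lay (A.map e.toEquiv.toEmbedding) (d * x) := by
    intro x
    ext z
    simp only [mem_lay, Finset.mem_map]
    refine exists_congr fun a => and_congr_right fun _ => ?_
    change (d⁻¹ * (e a).1, (e a).2) = (x, z) ↔ e a = (d * x, z)
    rw [Prod.ext_iff, Prod.ext_iff]
    simp only
    rw [inv_mul_eq_iff_eq_mul₀ h.d_ne]
  refine ⟨e.trans (scaleFst d⁻¹ hd), A.map (e.trans (scaleFst d⁻¹ hd)).toEquiv.toEmbedding,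
    y, L, w, himage _, Finset.card_map _, fun x hx => ?_, ?_, ?_, h.le, h.le', h.w_le, h.w_ge, h.eq⟩
  · refine h.supp _ (Finset.card_ne_zero.2 ⟨x.2, ?_⟩)
    rw [← hlay, mem_lay]
    exact hx
  · rw [hlay]; exact Finset.card_ne_zero.1 h.left
  · rw [hlay]; exact Finset.card_ne_zero.1 h.right

theorem eq_ajElt {k l m p : ℕ} [Fact p.Prime] (hlk : l < k) (hkp : k < p) {y : ZMod p}
    (hy : ((k : ZMod p) - l) * y = -(k * m + 1)) : y = ajElt k l m p 0 := by
  have h0 : ((k - l : ℕ) : ZMod p) ≠ 0 := by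
    rw [Ne, ZMod.natCast_eq_zero_iff]
    exact fun h => by have := Nat.le_of_dvd (by omega) h; omega
  rw [ajElt, ← div_eq_mul_inv, eq_div_iff h0, Nat.cast_sub hlk.le]
  push_cast
  linear_combination hy

theorem isTrivialKL_of_supp {k l m p n : ℕ} [Fact p.Prime] (hlk : l < k) (hkp : k < p)
    {A : Set (Fin n → ZMod p)} {e : (Fin n → ZMod p) ≃+ (ZMod p × (Fin (n - 1) → ZMod p))}
    {y : ZMod p} (hsupp : ∀ x ∈ e '' A, ∃ i : ℕ, i ≤ m ∧ x.1 = y + i)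
    (hy : ((k : ZMod p) - l) * y = -(k * m + 1)) : IsTrivialKL k l m 1 p n A := by
  refine ⟨e, 0, by norm_num, fun x hx => ?_⟩
  rw [← eq_ajElt hlk hkp hy]
  exact hsupp x hx

theorem isTrivialKL_of_supp_neg {k l m p n : ℕ} [Fact p.Prime] (hlk : l < k) (hkp : k < p)
    {A : Set (Fin n → ZMod p)} {e : (Fin n → ZMod p) ≃+ (ZMod p × (Fin (n - 1) → ZMod p))}
    {y : ZMod p} (hsupp : ∀ x ∈ e '' A, ∃ i : ℕ, i ≤ m ∧ x.1 = y + i)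
    (hy : ((k : ZMod p) - l) * (y + m) = k * m + 1) : IsTrivialKL k l m 1 p n A := by
  refine isTrivialKL_of_supp (e := e.trans (scaleFst (-1) (by simp))) (y := -(y + m)) hlk hkp ?_
    (by linear_combination -hy)
  rintro _ ⟨x, hx, rfl⟩
  obtain ⟨i, hi, h⟩ := hsupp _ ⟨x, hx, rfl⟩
  refine ⟨m - i, Nat.sub_le _ _, ?_⟩
  change -1 * (e x).1 = _
  rw [h, Nat.cast_sub hi]
  ring

theorem isType1_or_isTrivialKL {k l m p n : ℕ} [Fact p.Prime]
    (hkl : (k = 4 ∧ l = 1) ∨ (k = 3 ∧ l = 2)) (hp : p = 5 * m + 3) (hm : 21 ≤ m)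
    {A : Set (Fin n → ZMod p)} (hcard : m * p ^ (n - 1) ≤ A.ncard)
    {e : (Fin n → ZMod p) ≃+ (ZMod p × (Fin (n - 1) → ZMod p))}
    {D : Finset (ZMod p × (Fin (n - 1) → ZMod p))} (hD : e '' A = D) (hDA : D.card = A.ncard)
    {y : ZMod p} {w : ℤ} (hsupp : ∀ x ∈ D, ∃ i : ℕ, i ≤ m - 1 ∧ x.1 = y + i)
    (hw : w ≤ 0) (hw' : -3 ≤ w) (hy : ((k : ZMod p) - l) * y = w - k * (m - 1) - 1) :
    IsType1 k l m 1 p n A ∨ IsTrivialKL k l m 1 p n A := by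
  have hsupp' : ∀ x ∈ e '' A, ∃ i : ℕ, i ≤ m ∧ x.1 = y - 1 + i := by
    rw [hD]
    intro x hx
    obtain ⟨i, hi, h⟩ := hsupp x hx
    exact ⟨i + 1, by omega, by rw [h]; push_cast; ring⟩
  have hp0 := five_mul_add_three_eq_zero hp
  have htype : (((1 - w : ℤ) : ZMod p) ∈ Ival (1 : ZMod p) (l - 1) ∨ (1 + l + 2 ≤ k ∧
      ((1 - w : ℤ) : ZMod p) ∈ Ival ((1 + l + 2 : ℕ) : ZMod p) (k - (1 + l + 2)))) →
      IsType1 k l m 1 p n A := by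
    intro h
    obtain ⟨h1, h2⟩ := eq_cub_of_supp (by omega) (by omega) (by simp [ZMod.card])
      (hDA ▸ hcard) hsupp
    refine ⟨hDA.symm.trans h1, e, y, ?_, hD.trans h2⟩
    have : (l : ZMod p) * y - (k : ZMod p) * (y + (m : ZMod p) - 1) = ((1 - w : ℤ) : ZMod p) := by
      push_cast
      linear_combination -hy
    rwa [this]
  rcases hkl with ⟨rfl, rfl⟩ | ⟨rfl, rfl⟩
  · obtain rfl | rfl | rfl | rfl : w = 0 ∨ w = -1 ∨ w = -2 ∨ w = -3 := by omega
    · exact Or.inl (htype (Or.inl ⟨0, le_rfl, by simp⟩))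
    · right
      refine isTrivialKL_of_supp (by norm_num) (by omega) hsupp' ?_
      push_cast at hy ⊢
      linear_combination hy
    · right
      refine isTrivialKL_of_supp_neg (by norm_num) (by omega) hsupp' ?_
      push_cast at hy ⊢
      linear_combination hy - hp0
    · exact Or.inl (htype (Or.inr ⟨le_rfl, 0, le_rfl, by norm_num⟩))
  · obtain rfl | rfl | rfl | rfl : w = 0 ∨ w = -1 ∨ w = -2 ∨ w = -3 := by omega
    · exact Or.inl (htype (Or.inl ⟨0, by norm_num, by simp⟩))
    · exact Or.inl (htype (Or.inl ⟨1, by norm_num, by norm_num⟩))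
    · right
      refine isTrivialKL_of_supp (by norm_num) (by omega) hsupp' ?_
      push_cast at hy ⊢
      linear_combination hy
    · right
      refine isTrivialKL_of_supp_neg (by norm_num) (by omega) hsupp' ?_
      push_cast at hy ⊢
      linear_combination hy - hp0

theorem two_le_of_submodule_ne_top {p n : ℕ} (hn : 1 ≤ n)
    {V : Submodule (ZMod p) (Fin (n - 1) → ZMod p)} (hV : V ≠ ⊤) : 2 ≤ n := by
  by_contra h
  have : IsEmpty (Fin (n - 1)) := by
    rw [show n - 1 = 0 by omega]; infer_instance
  exact hV (Subsingleton.elim _ _)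

theorem isType3_or_isType4 {k l m p n : ℕ} [Fact p.Prime]
    (hkl : (k = 4 ∧ l = 1) ∨ (k = 3 ∧ l = 2)) (hp : p = 5 * m + 3) (hm : 21 ≤ m) (hn : 1 ≤ n)
    {A : Set (Fin n → ZMod p)} (hcard : A.ncard = m * p ^ (n - 1))
    {e : (Fin n → ZMod p) ≃+ (ZMod p × (Fin (n - 1) → ZMod p))} {y : ZMod p} (hy : y = 2 * m + 1)
    {V : Submodule (ZMod p) (Fin (n - 1) → ZMod p)}
    (he : e '' A =
      (({y, y + (m + 1 : ℕ)} : Set (ZMod p)) ×ˢ (V : Set (Fin (n - 1) → ZMod p))) ∪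
        (({y + 1, y + m} : Set (ZMod p)) ×ˢ (Set.univ \ (V : Set (Fin (n - 1) → ZMod p)))) ∪
        ((Ival (y + 2) (m - 3)) ×ˢ (Set.univ : Set (Fin (n - 1) → ZMod p)))) :
    IsType3 k l m p n A ∨ IsType4 m p n A := by
  have hp0 := five_mul_add_three_eq_zero hp
  by_cases hV : V = ⊤
  · left
    refine ⟨hcard, e, ?_⟩
    have h3a : type3a k l m p = y + 1 := by
      rcases hkl with ⟨rfl, rfl⟩ | ⟨rfl, rfl⟩
      · have h3 : ((4 - 1 : ℕ) : ZMod p) ≠ 0 := by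
          rw [Ne, ZMod.natCast_eq_zero_iff]
          exact fun h => by have := Nat.le_of_dvd (by omega) h; omega
        rw [type3a, ← div_eq_mul_inv, div_eq_iff h3, show 1 * m + 4 - 1 = m + 3 by omega, hy]
        push_cast
        linear_combination -hp0
      · rw [type3a, show 2 * m + 3 - 1 = 2 * m + 2 by omega, hy]
        norm_num
        ring
    rw [he, h3a, hV]
    have hinj : ∀ i j : ℕ, i ≤ m + 1 → j ≤ m + 1 → y + (i : ZMod p) = y + j → i = j := by
      intro i j hi hj h
      have h' := add_left_cancel h
      rw [ZMod.natCast_eq_natCast_iff'] at h'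
      rwa [Nat.mod_eq_of_lt (by omega), Nat.mod_eq_of_lt (by omega)] at h'
    ext ⟨j, x⟩
    simp only [Submodule.top_coe, Set.sdiff_self, Set.prod_empty, Set.union_empty, Set.mem_union,
      Set.mem_prod, Set.mem_univ, and_true, Set.mem_insert_iff, Set.mem_singleton_iff,
      Set.mem_ofPred_eq, Set.mem_sdiff, not_or, add_sub_cancel_right]
    constructor
    · intro h
      obtain ⟨i, hi, hi1, him, rfl⟩ : ∃ i : ℕ, i ≤ m + 1 ∧ i ≠ 1 ∧ i ≠ m ∧ j = y + i := by
        rcases h with (rfl | rfl) | ⟨i, hi, rfl⟩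
        · exact ⟨0, by omega, by omega, by omega, by simp⟩
        · exact ⟨m + 1, by omega, by omega, by omega, rfl⟩
        · exact ⟨i + 2, by omega, by omega, by omega, by push_cast; ring⟩
      refine ⟨⟨i, hi, rfl⟩, fun h => hi1 (hinj i 1 hi (by omega) (by rw [h]; simp)),
        fun h => him (hinj i m hi (by omega) (by rw [h]; ring))⟩
    · rintro ⟨⟨i, hi, rfl⟩, h1, h2⟩
      have hi1 : i ≠ 1 := by rintro rfl; simp at h1
      have him : i ≠ m := by rintro rfl; exact h2 (by ring)
      rcases Nat.eq_zero_or_pos i with rfl | hi0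
      · simp
      rcases hi.eq_or_lt with rfl | hi'
      · simp
      · refine Or.inr ⟨i - 2, by omega, ?_⟩
        rw [Nat.cast_sub (by omega)]; push_cast; ring
  · right
    refine ⟨two_le_of_submodule_ne_top hn hV, hcard, e, V, hV, ?_⟩
    rw [he, hy]
    congr 4 <;> push_cast <;> ring_nf

/-- (`(k,ℓ) ∈ {(4,1), (3,2)}`, `p = 5m+3`.) Every nontrivial
`(k,ℓ)`-sum-free set `A ⊆ F_p^n` with `|A| ≥ m·p^(n-1)` is normal, of type 3, or of type 4. -/
theorem stmt3 (k l n m p : ℕ) (τ : ℝ)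
    (hkl : (k = 4 ∧ l = 1) ∨ (k = 3 ∧ l = 2))
    (hn : 1 ≤ n) (hp : p = 5 * m + 3) (hpp : p.Prime)
    (hτ0 : 0 < τ) (hτ1 : τ ≤ 1) (hfeas : Feasible (1 / 5 : ℝ) τ)
    (hm1 : 5 / τ ≤ (m : ℝ)) (hm2 : 21 ≤ m)
    (A : Set (Fin n → ZMod p)) (hA : A.Nonempty) (hfree : KLFree k l A)
    (hnt : ¬ IsTrivialKL k l m 1 p n A) (hcard : m * p ^ (n - 1) ≤ A.ncard) :
    IsNormalKL k l m 1 p n A ∨ IsType3 k l m p n A ∨ IsType4 m p n A := by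
  have : Fact p.Prime := ⟨hpp⟩
  have hlk : l < k := by omega
  have hkp : k < p := by omega
  have hp0 := five_mul_add_three_eq_zero hp
  obtain ⟨ε, hε, hkε, hfree'⟩ : ∃ ε : ℤ, (ε = 1 ∨ ε = -1) ∧
      ((ε = 1 → k = 4 ∧ l = 1) ∧ (ε = -1 → k = 3 ∧ l = 2)) ∧ FreeEps ε A := by
    rcases hkl with ⟨rfl, rfl⟩ | ⟨rfl, rfl⟩
    · exact ⟨1, Or.inl rfl, by simp, hfree.freeEps_one⟩
    · exact ⟨-1, Or.inr rfl, by simp, hfree.freeEps_neg_one⟩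
  obtain ⟨e, D, y, L, w, hD, hDA, hsupp, h₀, h₁, hL, hL', hw, hw', hy⟩ :=
    hfree'.exists_addEquiv_supp hp hm2 hn hτ0 hfeas hm1 hε hA hcard
  have hy' : ((k : ZMod p) - l) * y = w - k * L - 1 := by
    rcases hy with ⟨h, hy⟩ | ⟨h, hy⟩
    · obtain ⟨rfl, rfl⟩ := hkε.1 h
      push_cast at hy ⊢
      linear_combination hy
    · obtain ⟨rfl, rfl⟩ := hkε.2 h
      push_cast at hy ⊢
      linear_combination hy
  have hfreeD : FreeEps ε (D : Set (ZMod p × (Fin (n - 1) → ZMod p))) := hD ▸ hfree'.image e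
  have hW : Fintype.card (Fin (n - 1) → ZMod p) = p ^ (n - 1) := by simp [ZMod.card]
  have hcardD : m * p ^ (n - 1) ≤ D.card := hDA ▸ hcard
  have himage : ∀ z, e.trans (shear z) '' A
      = shear z '' (D : Set (ZMod p × (Fin (n - 1) → ZMod p))) := fun z => by
    rw [← hD, Set.image_image]; rfl
  obtain rfl | rfl | rfl : L = m - 1 ∨ L = m ∨ L = m + 1 := by omega
  · rw [Nat.cast_sub (by omega), Nat.cast_one] at hy'
    rcases isType1_or_isTrivialKL hkl hp hm2 hcard hD hDA hsupp (by omega) (by omega) hy' with h | h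
    · exact Or.inl (Or.inl h)
    · exact absurd h hnt
  · obtain rfl | rfl : w = 0 ∨ w = 1 := by omega
    · refine absurd (isTrivialKL_of_supp (e := e) hlk hkp (by rwa [hD]) ?_) hnt
      push_cast at hy'
      linear_combination hy'
    · rcases hε with rfl | rfl
      · obtain ⟨rfl, rfl⟩ := hkε.1 rfl
        have hy3 : 3 * y = -(4 * L) := by
          push_cast at hy'
          linear_combination hy'
        obtain ⟨hDc, V, z, hV, h⟩ :=
          exists_submodule_of_supp_succ hp hm2 hW hfreeD hcardD hsupp h₀ h₁ hy3
        have h3 : ((1 : ℕ) : ZMod p) - ((4 : ℕ) : ZMod p) ≠ 0 := by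
          intro h
          have h' : ((3 : ℕ) : ZMod p) = 0 := by
            push_cast at h ⊢
            linear_combination -h
          rw [ZMod.natCast_eq_zero_iff] at h'
          have := Nat.le_of_dvd (by omega) h'
          omega
        have hya : type2a 4 1 L p = y := by
          rw [type2a, ← div_eq_mul_inv, div_eq_iff h3]
          push_cast
          linear_combination hy3
        refine Or.inl (Or.inr ⟨rfl, two_le_of_submodule_ne_top hn hV, hDA.symm.trans hDc,
          e.trans (shear z), V, hV, ?_⟩)
        rw [himage, h, hya]
      · obtain ⟨rfl, rfl⟩ := hkε.2 rfl
        refine (false_of_supp_succ hp hm2 hW hfreeD hcardD hsupp h₀ h₁ ?_).elim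
        push_cast at hy'
        linear_combination hy'
  · obtain rfl : w = 2 := by omega
    have hy2 : y = 2 * m + 1 := by
      rcases hkl with ⟨rfl, rfl⟩ | ⟨rfl, rfl⟩
      · have h3 : (3 : ZMod p) ≠ 0 := by
          intro h
          have h' : ((3 : ℕ) : ZMod p) = 0 := by exact_mod_cast h
          rw [ZMod.natCast_eq_zero_iff] at h'
          have := Nat.le_of_dvd (by omega) h'
          omega
        refine mul_left_cancel₀ h3 ?_
        push_cast at hy'
        linear_combination hy' - 2 * hp0
      · push_cast at hy'
        linear_combination hy' - hp0
    obtain ⟨hDc, V, z, h⟩ :=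
      exists_submodule_of_supp_succ_succ hp hm2 hW hε hfreeD hcardD hsupp h₀ h₁ hy2
    exact Or.inr (isType3_or_isType4 hkl hp hm2 hn (hDA.symm.trans hDc) hy2
      ((himage z).trans h))
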